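/- arXiv:2002.04590 — 7 statements merged into one kernel-verified Lean document; each statement's English description precedes it below -/
import Mathlib

section
/- Let G be a finite simple graph that is strongly regular with parameters (n, k, λ, μ). Then for every s with 3 ≤ s ≤ 7, the number of s-cycles through a vertex x is the same for every vertex x of G. -/
set_option linter.unusedSectionVars false

namespace SRGCycle

variable {s : ℕ}

/-- Boolean equality on `Fin s`, chosen for fast kernel evaluation. -/
def eqb (a b : Fin s) : Bool := Nat.beq a.val b.val

def memb (a : Fin s) (l : List (Fin s)) : Bool :=
  List.rec false (fun b _ ih => cond (eqb a b) true ih) l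

def memp (a b : Fin s) (l : List (Fin s × Fin s)) : Bool :=
  List.rec false (fun e _ ih => Prod.rec (fun c d => cond (eqb a c) (cond (eqb b d) true ih)
      (cond (eqb a d) (cond (eqb b c) true ih) ih)) e) l

def ins (a : Fin s) (l : List (Fin s)) : List (Fin s) := cond (memb a l) l (a :: l)

/-- The neighbours of `j` other than `j` itself. -/
def nbrs (j : Fin s) (E : List (Fin s × Fin s)) : List (Fin s) :=
  List.rec [] (fun e _ ih => Prod.rec (fun p q =>
    cond (eqb p j) (cond (eqb q j) ih (ins q ih)) (cond (eqb q j) (ins p ih) ih)) e) E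

/-- The edges that avoid `j`. -/
def off (j : Fin s) (E : List (Fin s × Fin s)) : List (Fin s × Fin s) :=
  List.rec [] (fun e _ ih => Prod.rec (fun p q =>
    cond (eqb p j) ih (cond (eqb q j) ih ((p, q) :: ih))) e) E

def loops (E : List (Fin s × Fin s)) : Bool :=
  List.rec true (fun e _ ih => Prod.rec (fun p q => cond (eqb p q) ih false) e) E

/-- Find a vertex other than the root with one or two neighbours. -/
def findStep (r : Fin s) (E : List (Fin s × Fin s)) : List (Fin s) → Option (Fin s × Fin s × Fin s)
  | [] => none
  | j :: l => cond (eqb j r) (findStep r E l)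
    (match nbrs j E with
    | [a] => some (j, a, a)
    | [a, b] => some (j, a, b)
    | _ => findStep r E l)

/-- Series-parallel reduction. -/
def check2 (r : Fin s) (L : List (Fin s)) : ℕ → List (Fin s × Fin s) → Bool
  | 0, E => loops E
  | n+1, E =>
    match findStep r E L with
    | none => loops E
    | some (j, a, b) => check2 r L n ((a, b) :: off j E)

/-- Substitute `i` for `j`. -/
def sb (i j : Fin s) (E : List (Fin s × Fin s)) : List (Fin s × Fin s) :=
  List.rec [] (fun e _ ih => Prod.rec (fun p q =>
    cond (eqb p j) (cond (eqb q j) ((i, i) :: ih) ((i, q) :: ih))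
      (cond (eqb q j) ((p, i) :: ih) ((p, q) :: ih))) e) E

/-- Deletion-contraction on the separated pairs `N`. -/
def check (r : Fin s) (L : List (Fin s)) : ℕ → List (Fin s × Fin s) → List (Fin s × Fin s) → Bool
  | 0, _, _ => false
  | n+1, E, N => cond (check2 r L n (E ++ N)) true
    (match N with
    | [] => false
    | (i, j) :: N' =>
      cond (eqb i j) true
      (cond (memp i j N') (check r L n E N')
      (cond (memp i j E) (check r L n ((i, j) :: E) N')
      (cond (check r L n E N')
        (cond (eqb j r) (check r L n (sb j i E) (sb j i N')) (check r L n (sb i j E) (sb i j N')))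
        false))))

/-- The edges of the cycle of length `s`. -/
def initE (s : ℕ) [NeZero s] : List (Fin s × Fin s) := (List.finRange s).map (fun i => (i, i+1))

/-- The pairs at distance at least two in the cycle of length `s`. -/
def initN (s : ℕ) [NeZero s] : List (Fin s × Fin s) :=
  (((List.finRange s).product (List.finRange s)).filter
    (fun e => decide (e.1 < e.2 ∧ e.2 ≠ e.1 + 1 ∧ e.1 ≠ e.2 + 1))).reverse

theorem eqb_iff {a b : Fin s} : eqb a b = true ↔ a = b := by
  unfold eqb
  rw [Nat.beq_eq, Fin.ext_iff]

theorem eqb_eq (a b : Fin s) : eqb a b = decide (a = b) := by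
  rw [Bool.eq_iff_iff, eqb_iff, decide_eq_true_eq]

theorem memb_iff {a : Fin s} {l : List (Fin s)} : memb a l = true ↔ a ∈ l := by
  induction l with
  | nil => simp [memb]
  | cons b l ih =>
    have h : memb a (b :: l) = cond (eqb a b) true (memb a l) := rfl
    rw [h, eqb_eq]
    by_cases hab : a = b <;> simp [hab, ← ih]

theorem memp_imp {a b : Fin s} {l : List (Fin s × Fin s)} (h : memp a b l = true) :
    (a, b) ∈ l ∨ (b, a) ∈ l := by
  induction l with
  | nil => simp [memp] at h
  | cons e l ih =>
    obtain ⟨c, d⟩ := e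
    have h' : memp a b ((c, d) :: l) = cond (eqb a c) (cond (eqb b d) true (memp a b l))
      (cond (eqb a d) (cond (eqb b c) true (memp a b l)) (memp a b l)) := rfl
    rw [h'] at h
    simp only [eqb_eq] at h
    simp only [List.mem_cons, Prod.mk.injEq]
    grind

theorem mem_ins {a z : Fin s} {l : List (Fin s)} : z ∈ ins a l ↔ z = a ∨ z ∈ l := by
  unfold ins
  cases h : memb a l with
  | false => simp
  | true =>
    have := memb_iff.1 h
    simp only [cond_true]
    grind

theorem nbrs_cons (j p q : Fin s) (E : List (Fin s × Fin s)) : nbrs j ((p, q) :: E) =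
    if p = j then (if q = j then nbrs j E else ins q (nbrs j E))
    else if q = j then ins p (nbrs j E) else nbrs j E := by
  have h : nbrs j ((p, q) :: E) = cond (eqb p j) (cond (eqb q j) (nbrs j E) (ins q (nbrs j E)))
      (cond (eqb q j) (ins p (nbrs j E)) (nbrs j E)) := rfl
  rw [h]
  simp only [eqb_eq, Bool.cond_decide]

theorem off_cons (j p q : Fin s) (E : List (Fin s × Fin s)) : off j ((p, q) :: E) =
    if p = j then off j E else if q = j then off j E else (p, q) :: off j E := by
  have h : off j ((p, q) :: E) =
      cond (eqb p j) (off j E) (cond (eqb q j) (off j E) ((p, q) :: off j E)) := rfl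
  rw [h]
  simp only [eqb_eq, Bool.cond_decide]

theorem sb_cons (i j p q : Fin s) (E : List (Fin s × Fin s)) : sb i j ((p, q) :: E) =
    (if p = j then i else p, if q = j then i else q) :: sb i j E := by
  have h : sb i j ((p, q) :: E) =
      cond (eqb p j) (cond (eqb q j) ((i, i) :: sb i j E) ((i, q) :: sb i j E))
      (cond (eqb q j) ((p, i) :: sb i j E) ((p, q) :: sb i j E)) := rfl
  rw [h]
  simp only [eqb_eq, Bool.cond_decide]
  split_ifs <;> rfl

theorem loops_imp {E : List (Fin s × Fin s)} (h : loops E = true) : ∀ e ∈ E, e.1 = e.2 := by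
  induction E with
  | nil => simp
  | cons e E ih =>
    obtain ⟨p, q⟩ := e
    have h' : loops ((p, q) :: E) = cond (eqb p q) (loops E) false := rfl
    rw [h', eqb_eq, Bool.cond_decide] at h
    split_ifs at h with hpq
    simpa [hpq] using ih h

/-! ### Soundness of the reduction procedure -/

variable {V : Type*} [Fintype V] [DecidableEq V] (G : SimpleGraph V) [DecidableRel G.Adj]

/-- Functions on pairs of vertices lying in the span of identity, adjacency, all-ones. -/
def IsM (g : V → V → ℚ) : Prop :=
  ∃ a b c : ℚ, ∀ u v, g u v = a * (if u = v then 1 else 0) + b * (if G.Adj u v then 1 else 0) + c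

variable {G}

theorem IsM.symm {g : V → V → ℚ} (hg : IsM G g) (u v : V) : g u v = g v u := by
  obtain ⟨a, b, c, h⟩ := hg
  rw [h, h]
  simp only [G.adj_comm u v, eq_comm (a := u) (b := v)]

theorem IsM.diag {g : V → V → ℚ} (hg : IsM G g) : ∃ c, ∀ u, g u u = c := by
  obtain ⟨a, b, c, h⟩ := hg
  exact ⟨a + c, fun u => by simp [h]⟩

theorem IsM.const (c : ℚ) : IsM G (fun _ _ => c) := ⟨0, 0, c, by simp⟩

theorem IsM.neq : IsM G (fun u v => if u ≠ v then 1 else 0) :=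
  ⟨-1, 0, 1, fun u v => by by_cases h : u = v <;> simp [h]⟩

theorem IsM.adj : IsM G (fun u v => if G.Adj u v then 1 else 0) := ⟨0, 1, 0, by simp⟩

theorem IsM.mul {g h : V → V → ℚ} (hg : IsM G g) (hh : IsM G h) :
    IsM G (fun u v => g u v * h u v) := by
  obtain ⟨a, b, c, hg⟩ := hg
  obtain ⟨a', b', c', hh⟩ := hh
  refine ⟨a * a' + a * c' + c * a', b * b' + b * c' + c * b', c * c', fun u v => ?_⟩
  simp only [hg, hh]
  by_cases h : u = v
  · subst h; simp; ring
  · by_cases h' : G.Adj u v <;> simp [h, h'] ; ring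

theorem sum_adj_adj {n k l m : ℕ} (hG : G.IsSRGWith n k l m) (u w : V) :
    ∑ v, (if G.Adj u v then (1 : ℚ) else 0) * (if G.Adj v w then 1 else 0) =
      ((k : ℚ) - m) * (if u = w then 1 else 0) + ((l : ℚ) - m) * (if G.Adj u w then 1 else 0)
        + m := by
  have h1 : ∑ v, (if G.Adj u v then (1 : ℚ) else 0) * (if G.Adj v w then 1 else 0) =
      (Fintype.card (G.commonNeighbors u w) : ℚ) := by
    have h2 : (G.commonNeighbors u w).toFinset =
        Finset.univ.filter (fun v => G.Adj u v ∧ G.Adj v w) := by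
      ext v
      simp [SimpleGraph.mem_commonNeighbors, G.adj_comm v w]
    rw [← Set.toFinset_card, h2, ← Finset.sum_boole]
    refine Finset.sum_congr rfl fun v _ => ?_
    by_cases h : G.Adj u v <;> simp [h]
  by_cases h : u = w
  · subst h
    have : ∑ v, (if G.Adj u v then (1 : ℚ) else 0) * (if G.Adj v u then 1 else 0) = k := by
      rw [← hG.regular u, ← SimpleGraph.card_neighborFinset_eq_degree]
      rw [SimpleGraph.neighborFinset_eq_filter, ← Finset.sum_boole]
      refine Finset.sum_congr rfl fun v _ => ?_
      by_cases h : G.Adj u v <;> simp [G.adj_comm v u, h]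
    rw [this]; simp
  · rw [h1]
    by_cases h' : G.Adj u w
    · rw [hG.of_adj _ _ h']; simp [h, h']
    · rw [hG.of_not_adj h h']; simp [h, h']

theorem IsM.conv {n k l m : ℕ} (hG : G.IsSRGWith n k l m) {g h : V → V → ℚ} (hg : IsM G g)
    (hh : IsM G h) : IsM G (fun u w => ∑ v, g u v * h v w) := by
  obtain ⟨a, b, c, hg⟩ := hg
  obtain ⟨a', b', c', hh⟩ := hh
  have hd : ∀ u : V, ∑ v, (if G.Adj u v then (1 : ℚ) else 0) = k := fun u => by
    rw [← hG.regular u, ← SimpleGraph.card_neighborFinset_eq_degree]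
    simp [SimpleGraph.neighborFinset_eq_filter]
  have hd' : ∀ u : V, ∑ v, (if G.Adj v u then (1 : ℚ) else 0) = k := fun u => by
    rw [← hd u]; simp only [G.adj_comm _ u]
  refine ⟨a * a' + b * b' * (k - m), a * b' + b * a' + b * b' * (l - m),
    a * c' + c * a' + b * b' * m + b * c' * k + c * b' * k + c * c' * Fintype.card V,
    fun u w => ?_⟩
  simp only [hg, hh]
  have key : ∀ v : V, (a * (if u = v then 1 else 0) + b * (if G.Adj u v then 1 else 0) + c) *
      (a' * (if v = w then 1 else 0) + b' * (if G.Adj v w then 1 else 0) + c') =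
      (if u = v then a * (a' * (if v = w then 1 else 0) + b' * (if G.Adj v w then 1 else 0) + c')
        else 0) +
      (if v = w then a' * (b * (if G.Adj u v then 1 else 0) + c) else 0) +
      b * b' * ((if G.Adj u v then (1 : ℚ) else 0) * (if G.Adj v w then 1 else 0)) +
      b * c' * (if G.Adj u v then 1 else 0) + c * b' * (if G.Adj v w then 1 else 0) + c * c' := by
    intro v
    split_ifs <;> ring
  simp only [key, Finset.sum_add_distrib, ← Finset.mul_sum, sum_adj_adj hG, hd, hd',
    Finset.sum_ite_eq, Finset.sum_ite_eq', Finset.mem_univ, if_true, Finset.sum_const,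
    Finset.card_univ, nsmul_eq_mul]
  ring

/-- Products of functions of the span indexed by a list of pairs. -/
inductive Sem (G : SimpleGraph V) [DecidableRel G.Adj] :
    List (Fin s × Fin s) → ((Fin s → V) → ℚ) → Prop
  | nil : Sem G [] (fun _ => 1)
  | cons {E F} (i j : Fin s) (g : V → V → ℚ) (hg : IsM G g) (hF : Sem G E F) :
      Sem G ((i, j) :: E) (fun f => g (f i) (f j) * F f)

/-- Rooted sum. -/
def rsum (r : Fin s) (x : V) (F : (Fin s → V) → ℚ) : ℚ :=
  ∑ f : Fin s → V, if f r = x then F f else 0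

theorem sum_update (j : Fin s) (H : (Fin s → V) → ℚ) :
    ∑ f : Fin s → V, ∑ v, H (Function.update f j v) = Fintype.card V * ∑ f, H f := by
  have h1 : ∑ p : (Fin s → V) × V, H (Function.update p.1 j p.2) =
      ∑ p : (Fin s → V) × V, H p.1 := by
    let e : (Fin s → V) × V → (Fin s → V) × V := fun p => (Function.update p.1 j p.2, p.1 j)
    have he : Function.Involutive e := fun p => by simp [e]
    exact Fintype.sum_equiv he.toPerm _ _ (fun p => rfl)
  rw [Fintype.sum_prod_type, Fintype.sum_prod_type] at h1
  rw [h1]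
  simp [Finset.mul_sum]

theorem rsum_update {r j : Fin s} (hj : j ≠ r) (x : V) (F : (Fin s → V) → ℚ) :
    Fintype.card V * rsum r x F = rsum r x (fun f => ∑ v, F (Function.update f j v)) := by
  unfold rsum
  rw [← sum_update j]
  refine Finset.sum_congr rfl fun f _ => ?_
  simp only [Function.update_of_ne hj.symm]
  split_ifs <;> simp

/-- The rooted sum does not depend on the root vertex. -/
def Cst (r : Fin s) (F : (Fin s → V) → ℚ) : Prop := ∀ x x' : V, rsum r x F = rsum r x' F

theorem cst_of_update {r j : Fin s} (hj : j ≠ r) {F : (Fin s → V) → ℚ}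
    (h : Cst r (fun f => ∑ v, F (Function.update f j v))) : Cst r F := by
  intro x x'
  have hc : (Fintype.card V : ℚ) ≠ 0 := by
    have : Nonempty V := ⟨x⟩
    exact_mod_cast Fintype.card_ne_zero
  apply mul_left_cancel₀ hc
  rw [rsum_update hj, rsum_update hj]
  exact h x x'

theorem cst_const (r : Fin s) (c : ℚ) : Cst r (fun _ : Fin s → V => c) := by
  intro x x'
  unfold rsum
  refine Fintype.sum_equiv (Equiv.arrowCongr (Equiv.refl _) (Equiv.swap x x')) _ _ (fun f => ?_)
  have : (Equiv.swap x x' (f r) = x') ↔ f r = x := by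
    rw [Equiv.swap_apply_eq_iff]; simp
  simp [Equiv.arrowCongr, this]

/-- Indicator that all listed pairs are separated. -/
def ind (N : List (Fin s × Fin s)) (f : Fin s → V) : ℚ :=
  if ∀ p ∈ N, f p.1 ≠ f p.2 then 1 else 0

theorem ind_cons (i j : Fin s) (N : List (Fin s × Fin s)) (f : Fin s → V) :
    ind ((i, j) :: N) f = (if f i ≠ f j then 1 else 0) * ind N f := by
  unfold ind
  by_cases h : f i = f j <;> simp [h]

def Inv (G : SimpleGraph V) [DecidableRel G.Adj] (r : Fin s) (E N : List (Fin s × Fin s)) : Prop :=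
  ∀ F, Sem G E F → Cst r (fun f => F f * ind N f)

def Inv0 (G : SimpleGraph V) [DecidableRel G.Adj] (r : Fin s) (E : List (Fin s × Fin s)) : Prop :=
  ∀ F, Sem G E F → Cst r F

theorem sem_ind (N : List (Fin s × Fin s)) : Sem G N (fun f => ind N f) := by
  induction N with
  | nil => simpa [ind] using Sem.nil
  | cons e N ih =>
    obtain ⟨i, j⟩ := e
    simp only [ind_cons]
    exact Sem.cons i j (fun u v => if u ≠ v then 1 else 0) IsM.neq ih

theorem sem_append {E N : List (Fin s × Fin s)} {F F' : (Fin s → V) → ℚ} (h : Sem G E F)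
    (h' : Sem G N F') : Sem G (E ++ N) (fun f => F f * F' f) := by
  induction h with
  | nil => simpa using h'
  | cons i j g hg hF ih =>
    simp only [mul_assoc]
    exact Sem.cons i j g hg ih

theorem inv_of_inv0 {r : Fin s} {E N : List (Fin s × Fin s)} (h : Inv0 G r (E ++ N)) :
    Inv G r E N := fun _ hF => h _ (sem_append hF (sem_ind N))

theorem sem_loops {E : List (Fin s × Fin s)} {F : (Fin s → V) → ℚ} (h : Sem G E F)
    (hl : ∀ e ∈ E, e.1 = e.2) : ∃ c, ∀ f, F f = c := by
  induction h with
  | nil => exact ⟨1, fun _ => rfl⟩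
  | cons i j g hg hF ih =>
    obtain ⟨c, hc⟩ := ih (fun e he => hl e (List.mem_cons_of_mem _ he))
    obtain ⟨d, hd⟩ := hg.diag
    have : i = j := hl (i, j) (List.mem_cons_self)
    subst this
    exact ⟨d * c, fun f => by simp only [hc, hd]⟩

theorem inv0_loops {r : Fin s} {E : List (Fin s × Fin s)} (hl : ∀ e ∈ E, e.1 = e.2) :
    Inv0 G r E := by
  intro F hF
  obtain ⟨c, hc⟩ := sem_loops hF hl
  have : F = fun _ => c := funext hc
  rw [this]
  exact cst_const r c

theorem sem_elim {E : List (Fin s × Fin s)} {F : (Fin s → V) → ℚ} {j a b : Fin s}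
    (h : Sem G E F)
    (h1 : ∀ e ∈ E, e.1 = j → e.2 = j ∨ e.2 = a ∨ e.2 = b)
    (h2 : ∀ e ∈ E, e.2 = j → e.1 = j ∨ e.1 = a ∨ e.1 = b) (ha : a ≠ j) (hb : b ≠ j) :
    ∃ F' g h, Sem G (off j E) F' ∧ IsM G g ∧ IsM G h ∧
      ∀ f v, F (Function.update f j v) = F' f * (g (f a) v * h v (f b)) := by
  induction h with
  | nil => exact ⟨_, _, _, Sem.nil, IsM.const 1, IsM.const 1, fun f v => by simp⟩
  | @cons E F p q t ht hF ih =>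
    obtain ⟨F', g, h, hF', hg, hh, key⟩ := ih (fun e he => h1 e (List.mem_cons_of_mem _ he))
      (fun e he => h2 e (List.mem_cons_of_mem _ he))
    have h1 := h1 (p, q) List.mem_cons_self
    have h2 := h2 (p, q) List.mem_cons_self
    dsimp only at h1 h2
    -- the four ways in which the new edge meets `j`
    have useA : ∀ E', off j E' = off j E →
        (∀ (f : Fin s → V) (v : V), t (Function.update f j v p) (Function.update f j v q) = t (f a) v) →
        ∃ F'' g h, Sem G (off j E') F'' ∧ IsM G g ∧ IsM G h ∧ ∀ f v,
          t (Function.update f j v p) (Function.update f j v q) * F (Function.update f j v) =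
          F'' f * (g (f a) v * h v (f b)) := fun E' hE hf =>
      ⟨F', _, h, hE ▸ hF', ht.mul hg, hh, fun f v => by rw [hf, key]; ring⟩
    have useB : ∀ E', off j E' = off j E →
        (∀ (f : Fin s → V) (v : V), t (Function.update f j v p) (Function.update f j v q) = t v (f b)) →
        ∃ F'' g h, Sem G (off j E') F'' ∧ IsM G g ∧ IsM G h ∧ ∀ f v,
          t (Function.update f j v p) (Function.update f j v q) * F (Function.update f j v) =
          F'' f * (g (f a) v * h v (f b)) := fun E' hE hf =>
      ⟨F', g, _, hE ▸ hF', hg, ht.mul hh, fun f v => by rw [hf, key]; ring⟩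
    by_cases hp : p = j
    · have hoff : off j ((p, q) :: E) = off j E := by simp [off_cons, hp]
      rcases h1 hp with h | h | h
      · obtain ⟨d, hd⟩ := ht.diag
        refine ⟨F', _, _, hoff ▸ hF', (IsM.const d).mul hg, hh, fun f v => ?_⟩
        simp only [hd, hp, h, key]; ring
      · exact useA _ hoff (fun f v => by rw [hp, h, ht.symm]; simp [ha])
      · exact useB _ hoff (fun f v => by rw [hp, h]; simp [hb])
    · by_cases hq : q = j
      · have hoff : off j ((p, q) :: E) = off j E := by simp [off_cons, hq]
        rcases h2 hq with h | h | h
        · exact absurd h hp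
        · exact useA _ hoff (fun f v => by rw [hq, h]; simp [ha])
        · exact useB _ hoff (fun f v => by rw [hq, h, ht.symm]; simp [hb])
      · have hoff : off j ((p, q) :: E) = (p, q) :: off j E := by simp [off_cons, hp, hq]
        rw [hoff]
        refine ⟨_, g, h, Sem.cons p q t ht hF', hg, hh, fun f v => ?_⟩
        simp only [key, Function.update_of_ne hp, Function.update_of_ne hq]; ring

theorem inv0_elim {n k l m : ℕ} (hG : G.IsSRGWith n k l m) {r : Fin s}
    {E : List (Fin s × Fin s)} {j a b : Fin s} (hj : j ≠ r)
    (h1 : ∀ e ∈ E, e.1 = j → e.2 = j ∨ e.2 = a ∨ e.2 = b)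
    (h2 : ∀ e ∈ E, e.2 = j → e.1 = j ∨ e.1 = a ∨ e.1 = b) (ha : a ≠ j) (hb : b ≠ j)
    (h : Inv0 G r ((a, b) :: off j E)) : Inv0 G r E := by
  intro F hF
  obtain ⟨F', g, t, hF', hg, ht, key⟩ := sem_elim hF h1 h2 ha hb
  apply cst_of_update hj
  simp only [key, ← Finset.mul_sum]
  have := h _ (Sem.cons a b _ (IsM.conv hG hg ht) hF')
  simpa only [mul_comm] using this

theorem nbrs_spec (j : Fin s) (E : List (Fin s × Fin s)) :
    j ∉ nbrs j E ∧ (∀ e ∈ E, e.1 = j → e.2 = j ∨ e.2 ∈ nbrs j E) ∧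
      (∀ e ∈ E, e.2 = j → e.1 = j ∨ e.1 ∈ nbrs j E) := by
  induction E with
  | nil => simp [nbrs]
  | cons e E ih =>
    obtain ⟨i1, i2, i3⟩ := ih
    obtain ⟨p, q⟩ := e
    have hm : ∀ z, z ∈ nbrs j ((p, q) :: E) ↔
        (z = q ∧ p = j ∧ q ≠ j) ∨ (z = p ∧ q = j ∧ p ≠ j) ∨ z ∈ nbrs j E := by
      intro z
      rw [nbrs_cons]
      split_ifs <;> simp_all [mem_ins]
    simp only [hm, List.forall_mem_cons]
    refine ⟨by grind, ⟨by grind, by grind⟩, by grind, by grind⟩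

theorem findStep_spec {r : Fin s} {E : List (Fin s × Fin s)} {L : List (Fin s)} {j a b : Fin s}
    (h : findStep r E L = some (j, a, b)) :
    j ≠ r ∧ a ∈ nbrs j E ∧ b ∈ nbrs j E ∧ ∀ z ∈ nbrs j E, z = a ∨ z = b := by
  induction L with
  | nil => simp [findStep] at h
  | cons i L ih =>
    simp only [findStep] at h
    rw [eqb_eq, Bool.cond_decide] at h
    split_ifs at h with hi
    · exact ih h
    · split at h
      · rename_i a' he
        simp only [Option.some.injEq, Prod.mk.injEq] at h
        obtain ⟨rfl, rfl, rfl⟩ := h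
        simp [he, hi]
      · rename_i a' b' he
        simp only [Option.some.injEq, Prod.mk.injEq] at h
        obtain ⟨rfl, rfl, rfl⟩ := h
        simp [he, hi]
      · exact ih h

theorem check2_sound {n k l m : ℕ} (hG : G.IsSRGWith n k l m) (r : Fin s) (L : List (Fin s))
    (t : ℕ) (E : List (Fin s × Fin s)) (h : check2 r L t E = true) : Inv0 G r E := by
  induction t generalizing E with
  | zero => exact inv0_loops (loops_imp h)
  | succ t ih =>
    simp only [check2] at h
    split at h
    · exact inv0_loops (loops_imp h)
    · rename_i j a b hf
      obtain ⟨hj, ha, hb, hz⟩ := findStep_spec hf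
      obtain ⟨n1, n2, n3⟩ := nbrs_spec j E
      exact inv0_elim hG hj (fun e he h => (n2 e he h).imp id (hz _))
        (fun e he h => (n3 e he h).imp id (hz _)) (fun h => n1 (h ▸ ha)) (fun h => n1 (h ▸ hb))
        (ih _ h)

theorem update_sb (i j : Fin s) (f : Fin s → V) (p : Fin s) :
    Function.update f j (f i) p = f (if p = j then i else p) := by
  by_cases h : p = j
  · subst h; simp
  · simp [h]

theorem sem_sb {E : List (Fin s × Fin s)} {F : (Fin s → V) → ℚ} (i j : Fin s) (h : Sem G E F) :
    Sem G (sb i j E) (fun f => F (Function.update f j (f i))) := by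
  induction h with
  | nil => exact Sem.nil
  | cons p q g hg hF ih =>
    simp only [update_sb i j _ p, update_sb i j _ q, sb_cons]
    exact Sem.cons _ _ g hg ih

theorem ind_sb (N : List (Fin s × Fin s)) (i j : Fin s) (f : Fin s → V) :
    ind N (Function.update f j (f i)) = ind (sb i j N) f := by
  induction N with
  | nil => simp [ind, sb]
  | cons e N ih =>
    obtain ⟨p, q⟩ := e
    rw [sb_cons, ind_cons, ind_cons, ih, update_sb, update_sb]

theorem rsum_sub (r : Fin s) (x : V) (F F' : (Fin s → V) → ℚ) :
    rsum r x (fun f => F f - F' f) = rsum r x F - rsum r x F' := by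
  unfold rsum
  rw [← Finset.sum_sub_distrib]
  refine Finset.sum_congr rfl fun f _ => ?_
  split_ifs <;> simp

theorem inv_contract {r i j : Fin s} {E N : List (Fin s × Fin s)} (hj : j ≠ r) (hij : i ≠ j)
    (h1 : Inv G r E N) (h2 : Inv G r (sb i j E) (sb i j N)) : Inv G r E ((i, j) :: N) := by
  intro F hF
  have hc : Cst r (fun f => (if f i = f j then 1 else 0) * (F f * ind N f)) := by
    apply cst_of_update hj
    simp only [Function.update_of_ne hij, Function.update_self]
    have : ∀ f : Fin s → V, ∑ v, (if f i = v then (1 : ℚ) else 0) *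
        (F (Function.update f j v) * ind N (Function.update f j v)) =
        F (Function.update f j (f i)) * ind (sb i j N) f := fun f => by
      simp [ind_sb]
    simp only [this]
    exact h2 _ (sem_sb i j hF)
  have he : (fun f => F f * ind ((i, j) :: N) f) =
      fun f => (F f * ind N f) - (if f i = f j then 1 else 0) * (F f * ind N f) := by
    funext f
    rw [ind_cons]
    by_cases h : f i = f j <;> simp [h]
  intro x x'
  rw [he, rsum_sub, rsum_sub, h1 F hF x x', hc x x']

theorem inv_swap {r i j : Fin s} {E N : List (Fin s × Fin s)} (h : Inv G r E ((i, j) :: N)) :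
    Inv G r E ((j, i) :: N) := by
  intro F hF
  have := h F hF
  simp only [ind_cons] at this ⊢
  simpa only [ne_comm] using this

theorem inv_redundant {r : Fin s} {e : Fin s × Fin s} {E N : List (Fin s × Fin s)} (he : e ∈ N)
    (h : Inv G r E N) : Inv G r E (e :: N) := by
  intro F hF
  have := h F hF
  have hi : ∀ f : Fin s → V, ind (e :: N) f = ind N f := fun f => by
    unfold ind
    congr 1
    rw [List.forall_mem_cons, eq_iff_iff]
    exact ⟨fun h => h.2, fun h => ⟨h e he, h⟩⟩
  simpa only [hi] using this

theorem inv_absorb {r i j : Fin s} {E N : List (Fin s × Fin s)} (h : Inv G r ((i, j) :: E) N) :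
    Inv G r E ((i, j) :: N) := by
  intro F hF
  have := h _ (Sem.cons i j (fun u v => if u ≠ v then 1 else 0) IsM.neq hF)
  simp only [ind_cons]
  refine Eq.mp (congrArg (Cst r) ?_) this
  funext f
  ring

theorem check_sound {n k l m : ℕ} (hG : G.IsSRGWith n k l m) (r : Fin s) (L : List (Fin s))
    (t : ℕ) (E N : List (Fin s × Fin s)) (h : check r L t E N = true) : Inv G r E N := by
  induction t generalizing E N with
  | zero => simp [check] at h
  | succ t ih =>
    simp only [check] at h
    cases hc : check2 r L t (E ++ N) with
    | true => exact inv_of_inv0 (check2_sound hG r _ _ _ hc)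
    | false =>
      rw [hc, cond_false] at h
      split at h
      · simp at h
      · rename_i i j N'
        simp only [eqb_eq, Bool.cond_decide] at h
        split_ifs at h with h1 h3
        · subst h1
          intro F hF
          have : (fun f : Fin s → V => F f * ind ((i, i) :: N') f) = fun _ => 0 := by
            funext f; simp [ind_cons]
          rw [this]
          exact cst_const r 0
        all_goals
          cases hm : memp i j N' with
          | true =>
            rw [hm, cond_true] at h
            rcases memp_imp hm with h2 | h2
            · exact inv_redundant h2 (ih _ _ h)
            · exact inv_swap (inv_redundant h2 (ih _ _ h))
          | false =>
          rw [hm, cond_false] at h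
          cases hm' : memp i j E with
          | true =>
            rw [hm', cond_true] at h
            exact inv_absorb (ih _ _ h)
          | false =>
          rw [hm', cond_false] at h
          cases hd : check r L t E N' with
          | false => simp [hd] at h
          | true =>
          rw [hd, cond_true] at h
          first
          | exact inv_contract h3 h1 (ih _ _ hd) (ih _ _ h)
          | exact inv_swap (inv_contract (h3 ▸ h1) (fun h => h1 h.symm) (ih _ _ hd) (ih _ _ h))

/-! ### Cycles as closed injective sequences -/

theorem sem_adj (E : List (Fin s × Fin s)) :
    Sem G E (fun f => if ∀ p ∈ E, G.Adj (f p.1) (f p.2) then 1 else 0) := by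
  induction E with
  | nil => simpa using Sem.nil
  | cons e E ih =>
    obtain ⟨i, j⟩ := e
    convert Sem.cons i j (fun u v => if G.Adj u v then 1 else 0) IsM.adj ih using 2 with f
    by_cases h : G.Adj (f i) (f j) <;> simp [h]

/-- The closed injective sequences starting at `x`. -/
def CycSeq (G : SimpleGraph V) (s : ℕ) [NeZero s] (x : V) (f : Fin s → V) : Prop :=
  f 0 = x ∧ (∀ i, G.Adj (f i) (f (i + 1))) ∧ Function.Injective f

theorem cycSeq_iff [NeZero s] (x : V) (f : Fin s → V) : CycSeq G s x f ↔
    f 0 = x ∧ (∀ p ∈ initE s, G.Adj (f p.1) (f p.2)) ∧ ∀ p ∈ initN s, f p.1 ≠ f p.2 := by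
  unfold CycSeq
  refine and_congr_right fun _ => ?_
  have hE : (∀ p ∈ initE s, G.Adj (f p.1) (f p.2)) ↔ ∀ i, G.Adj (f i) (f (i + 1)) := by
    simp [initE]
  rw [hE]
  refine and_congr_right fun ha => ⟨fun hi p hp => ?_, fun hn => ?_⟩
  · simp only [initN, List.mem_reverse, List.mem_filter, decide_eq_true_eq] at hp
    exact fun h => hp.2.1.ne (hi h)
  · have hlt : ∀ i j : Fin s, i < j → f i ≠ f j := by
      intro i j hij
      by_cases h1 : j = i + 1
      · rw [h1]; exact (ha i).ne
      · by_cases h2 : i = j + 1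
        · rw [h2]; exact (ha j).ne'
        · refine hn (i, j) ?_
          simp only [initN, List.mem_reverse, List.mem_filter, decide_eq_true_eq]
          exact ⟨List.pair_mem_product.2 ⟨List.mem_finRange _, List.mem_finRange _⟩, hij, h1, h2⟩
    intro i j hij
    rcases lt_trichotomy i j with h | h | h
    · exact absurd hij (hlt i j h)
    · exact h
    · exact absurd hij.symm (hlt j i h)

theorem card_cycSeq [NeZero s] (x : V) : (Nat.card {f : Fin s → V // CycSeq G s x f} : ℚ) =
    rsum 0 x (fun f => (if ∀ p ∈ initE s, G.Adj (f p.1) (f p.2) then 1 else 0) *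
      ind (initN s) f) := by
  classical
  rw [Nat.card_eq_fintype_card, Fintype.card_subtype, ← Finset.sum_boole]
  unfold rsum
  refine Finset.sum_congr rfl fun f _ => ?_
  simp only [cycSeq_iff, ind]
  split_ifs <;> first | tauto | simp

theorem exists_walk (g : ℕ → V) (n : ℕ) (hg : ∀ i < n, G.Adj (g i) (g (i + 1))) :
    ∃ w : G.Walk (g 0) (g n), w.length = n ∧ ∀ i ≤ n, w.getVert i = g i := by
  induction n generalizing g with
  | zero => exact ⟨SimpleGraph.Walk.nil, rfl, fun i hi => by simp [Nat.le_zero.1 hi]⟩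
  | succ n ih =>
    obtain ⟨w, hw, hv⟩ := ih (fun i => g (i + 1)) (fun i hi => hg (i + 1) (by omega))
    refine ⟨SimpleGraph.Walk.cons (hg 0 (by omega)) w, by simp [hw], fun i hi => ?_⟩
    cases i with
    | zero => simp
    | succ i => simpa using hv i (by omega)

theorem card_cycles [NeZero s] (hs : 3 ≤ s) (x : V) :
    Nat.card {w : G.Walk x x // w.IsCycle ∧ w.length = s} =
      Nat.card {f : Fin s → V // CycSeq G s x f} := by
  have hval : ∀ (i : Fin s) (w : G.Walk x x), w.length = s →
      w.getVert ((i + 1 : Fin s) : ℕ) = w.getVert ((i : ℕ) + 1) := by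
    intro i w hw
    by_cases hi : (i : ℕ) + 1 < s
    · rw [Fin.val_add_one_of_lt' hi]
    · have h1 : (i : ℕ) + 1 = s := by omega
      have h2 : ((i + 1 : Fin s) : ℕ) = 0 := by
        rw [Fin.val_add, Fin.coe_ofNat_eq_mod, Nat.add_mod_mod, h1, Nat.mod_self]
      rw [h1, h2, ← hw]; simp
  refine Nat.card_eq_of_bijective (fun w => ⟨fun i => w.1.getVert i, ?_, ?_, ?_⟩) ⟨?_, ?_⟩
  · simp
  · intro i
    change G.Adj (w.1.getVert i) (w.1.getVert ((i + 1 : Fin s) : ℕ))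
    rw [hval i w.1 w.2.2]
    exact w.1.adj_getVert_succ (by rw [w.2.2]; exact i.2)
  · intro i j hij
    have := w.2.1.getVert_injOn' (x₁ := i) (x₂ := j)
      (by have := w.2.2; have := i.2; simp; omega) (by have := w.2.2; have := j.2; simp; omega) hij
    exact Fin.ext this
  · rintro ⟨w, hw, hl⟩ ⟨w', hw', hl'⟩ h
    have h := congrArg Subtype.val h
    apply Subtype.ext
    refine SimpleGraph.Walk.ext_getVert_le_length (by rw [hl, hl']) fun i hi => ?_
    by_cases h' : i < s
    · exact congrFun h ⟨i, h'⟩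
    · have : i = s := by dsimp only at hi; omega
      subst this
      have e1 : w.getVert i = x := by conv_lhs => rw [← hl]; simp
      have e2 : w'.getVert i = x := by conv_lhs => rw [← hl']; simp
      rw [e1, e2]
  · rintro ⟨f, h0, ha, hi⟩
    let g : ℕ → V := fun i => f (Fin.ofNat s i)
    obtain ⟨w, hw, hv⟩ := exists_walk (G := G) g s (fun i hi => by
      have : Fin.ofNat s (i + 1) = Fin.ofNat s i + 1 := by
        apply Fin.ext; simp [Fin.val_add]
      simp only [g, this]
      exact ha _)
    have hg0 : g 0 = x := by simp [g, ← h0]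
    have hgs : g s = x := by
      simp [g, ← h0]
    have hgf : ∀ i : Fin s, g i = f i := fun i => by simp [g]
    have hginj : ∀ a b, g a = g b → a % s = b % s := fun a b h => by
      simpa using congrArg Fin.val (hi h)
    clear_value g
    revert w
    rw [hg0, hgs]
    intro w hw hv
    refine ⟨⟨w, ?_, hw⟩, ?_⟩
    · rw [SimpleGraph.Walk.isCycle_iff_isPath_tail_and_le_length]
      refine ⟨?_, by omega⟩
      rw [← SimpleGraph.Walk.IsPath.getVert_injOn_iff]
      intro a ha' b hb' hab
      have hl := w.length_tail_add_one (by
        intro h; have := SimpleGraph.Walk.length_eq_zero_iff.2 h; omega)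
      simp only [Set.mem_ofPred_eq] at ha' hb'
      rw [SimpleGraph.Walk.getVert_tail, SimpleGraph.Walk.getVert_tail, hv _ (by omega),
        hv _ (by omega)] at hab
      have hm := hginj _ _ hab
      rcases Nat.lt_or_ge (a + 1) s with h1 | h1 <;> rcases Nat.lt_or_ge (b + 1) s with h2 | h2
      · rw [Nat.mod_eq_of_lt h1, Nat.mod_eq_of_lt h2] at hm; omega
      · have : b + 1 = s := by omega
        rw [Nat.mod_eq_of_lt h1, this, Nat.mod_self] at hm; omega
      · have : a + 1 = s := by omega
        rw [Nat.mod_eq_of_lt h2, this, Nat.mod_self] at hm; omega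
      · omega
    · apply Subtype.ext
      funext i
      change w.getVert i = f i
      rw [hv i i.2.le, hgf]

theorem cycles_invariant {n k l m : ℕ} (hG : G.IsSRGWith n k l m) [NeZero s] (hs : 3 ≤ s)
    (L : List (Fin s)) (E N : List (Fin s × Fin s))
    (hE : initE s = E) (hN : initN s = N) (h : check 0 L 20 E N = true) (x x' : V) :
    Nat.card {w : G.Walk x x // w.IsCycle ∧ w.length = s} =
      Nat.card {w : G.Walk x' x' // w.IsCycle ∧ w.length = s} := by
  subst hE hN
  rw [card_cycles hs, card_cycles hs]
  have := check_sound hG 0 _ 20 _ _ h _ (sem_adj _) x x'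
  rw [← card_cycSeq, ← card_cycSeq] at this
  exact_mod_cast this

end SRGCycle

/-- In a strongly regular graph `G`, for every `3 ≤ s ≤ 7` the
number of `s`-cycles passing through a vertex `x` is the same for every vertex `x`. -/
theorem srg_cycle_through_vertex_count_invariant {V : Type*} [Fintype V]
    (G : SimpleGraph V) [DecidableRel G.Adj] (n k l m : ℕ)
    (hG : G.IsSRGWith n k l m) :
    ∀ s : ℕ, 3 ≤ s → s ≤ 7 → ∀ x x' : V,
      Nat.card {w : G.Walk x x // w.IsCycle ∧ w.length = s} =
      Nat.card {w : G.Walk x' x' // w.IsCycle ∧ w.length = s} := by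
  classical
  intro s h3 h7
  interval_cases s
  · exact SRGCycle.cycles_invariant hG (by norm_num) [0, 1, 2]
      [(0, 1), (1, 2), (2, 0)]
      []
      (by decide +kernel) (by decide +kernel) (by decide +kernel)
  · exact SRGCycle.cycles_invariant hG (by norm_num) [0, 1, 2, 3]
      [(0, 1), (1, 2), (2, 3), (3, 0)]
      [(1, 3), (0, 2)]
      (by decide +kernel) (by decide +kernel) (by decide +kernel)
  · exact SRGCycle.cycles_invariant hG (by norm_num) [0, 1, 2, 3, 4]
      [(0, 1), (1, 2), (2, 3), (3, 4), (4, 0)]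
      [(2, 4), (1, 4), (1, 3), (0, 3), (0, 2)]
      (by decide +kernel) (by decide +kernel) (by decide +kernel)
  · exact SRGCycle.cycles_invariant hG (by norm_num) [0, 1, 2, 3, 4, 5]
      [(0, 1), (1, 2), (2, 3), (3, 4), (4, 5), (5, 0)]
      [(3, 5), (2, 5), (2, 4), (1, 5), (1, 4), (1, 3), (0, 4), (0, 3), (0, 2)]
      (by decide +kernel) (by decide +kernel) (by decide +kernel)
  · exact SRGCycle.cycles_invariant hG (by norm_num) [0, 1, 2, 3, 4, 5, 6]
      [(0, 1), (1, 2), (2, 3), (3, 4), (4, 5), (5, 6), (6, 0)]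
      [(4, 6), (3, 6), (3, 5), (2, 6), (2, 5), (2, 4), (1, 6), (1, 5), (1, 4), (1, 3), (0, 5), (0, 4), (0, 3), (0, 2)]
      (by decide +kernel) (by decide +kernel) (by decide +kernel)
end

section
/- Let G be a finite simple graph that is strongly regular with parameters (n, k, λ, μ). Then for every s with 3 ≤ s ≤ 7 and any vertices x, y, x', y' with G.Adj x y and G.Adj x' y', the number of s-cycles containing the edge {x, y} equals the number of s-cycles containing the edge {x', y'}. -/
set_option linter.unusedSectionVars false

namespace SrgCycle

open Finset

/-- Coherent functions: elements of the adjacency algebra. -/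
def Coh {V : Type*} (G : SimpleGraph V) (f : V → V → ℤ) : Prop :=
  ∃ a b c : ℤ, ∀ u v, (u = v → f u v = a) ∧ (G.Adj u v → f u v = b) ∧
    (u ≠ v → ¬ G.Adj u v → f u v = c)

section basic
variable {V : Type*} [DecidableEq V] {G : SimpleGraph V} [DecidableRel G.Adj]

theorem Coh.const (c : ℤ) : Coh G (fun _ _ => c) :=
  ⟨c, c, c, fun _ _ => ⟨fun _ => rfl, fun _ => rfl, fun _ _ => rfl⟩⟩

theorem Coh.mul {f g : V → V → ℤ} (hf : Coh G f) (hg : Coh G g) :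
    Coh G (fun u v => f u v * g u v) := by
  obtain ⟨a, b, c, h⟩ := hf
  obtain ⟨a', b', c', h'⟩ := hg
  refine ⟨a * a', b * b', c * c', fun u v => ?_⟩
  obtain ⟨h1, h2, h3⟩ := h u v
  obtain ⟨h1', h2', h3'⟩ := h' u v
  exact ⟨fun e => by simp only [h1 e, h1' e], fun e => by simp only [h2 e, h2' e],
    fun e e' => by simp only [h3 e e', h3' e e']⟩

theorem Coh.add {f g : V → V → ℤ} (hf : Coh G f) (hg : Coh G g) :
    Coh G (fun u v => f u v + g u v) := by
  obtain ⟨a, b, c, h⟩ := hf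
  obtain ⟨a', b', c', h'⟩ := hg
  refine ⟨a + a', b + b', c + c', fun u v => ?_⟩
  obtain ⟨h1, h2, h3⟩ := h u v
  obtain ⟨h1', h2', h3'⟩ := h' u v
  exact ⟨fun e => by simp only [h1 e, h1' e], fun e => by simp only [h2 e, h2' e],
    fun e e' => by simp only [h3 e e', h3' e e']⟩

theorem Coh.sub {f g : V → V → ℤ} (hf : Coh G f) (hg : Coh G g) :
    Coh G (fun u v => f u v - g u v) := by
  have := hf.add ((Coh.const (-1)).mul hg)
  simpa [sub_eq_add_neg] using this

theorem Coh.symm {f : V → V → ℤ} (hf : Coh G f) (u v : V) : f u v = f v u := by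
  obtain ⟨a, b, c, h⟩ := hf
  obtain ⟨h1, h2, h3⟩ := h u v
  obtain ⟨h1', h2', h3'⟩ := h v u
  by_cases e : u = v
  · rw [e]
  · by_cases e' : G.Adj u v
    · rw [h2 e', h2' e'.symm]
    · rw [h3 e e', h3' (Ne.symm e) (fun h => e' h.symm)]

theorem Coh.diag {f : V → V → ℤ} (hf : Coh G f) : ∃ a, ∀ u, f u u = a := by
  obtain ⟨a, b, c, h⟩ := hf
  exact ⟨a, fun u => (h u u).1 rfl⟩

theorem coh_eq : Coh G (fun u v => if u = v then (1 : ℤ) else 0) :=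
  ⟨1, 0, 0, fun u v => ⟨fun e => by simp [e], fun e => by simp [e.ne], fun e _ => by simp [e]⟩⟩

theorem coh_ne : Coh G (fun u v => if u ≠ v then (1 : ℤ) else 0) :=
  ⟨0, 1, 1, fun u v => ⟨fun e => by simp [e], fun e => by simp [e.ne], fun e _ => by simp [e]⟩⟩

theorem coh_adj : Coh G (fun u v => if G.Adj u v then (1 : ℤ) else 0) :=
  ⟨0, 1, 0, fun u v => ⟨fun e => by simp [e], fun e => by simp [e], fun _ e => by simp [e]⟩⟩

theorem Coh.expand {f : V → V → ℤ} (hf : Coh G f) : ∃ a b c : ℤ, ∀ u v,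
    f u v = a * (if u = v then (1 : ℤ) else 0) + b * (if G.Adj u v then (1 : ℤ) else 0) + c := by
  obtain ⟨a, b, c, h⟩ := hf
  refine ⟨a - c, b - c, c, fun u v => ?_⟩
  obtain ⟨h1, h2, h3⟩ := h u v
  by_cases e : u = v
  · rw [h1 e]; subst e; simp
  · by_cases e' : G.Adj u v
    · rw [h2 e']; simp [e, e']
    · rw [h3 e e']; simp [e, e']

end basic

section main
variable {V : Type*} [Fintype V] [DecidableEq V] {G : SimpleGraph V} [DecidableRel G.Adj]

theorem coh_common {n k l m : ℕ} (hG : G.IsSRGWith n k l m) :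
    Coh G (fun u v => ∑ w, (if G.Adj u w then (1 : ℤ) else 0) *
      (if G.Adj v w then (1 : ℤ) else 0)) := by
  have key : ∀ u v, (∑ w, (if G.Adj u w then (1 : ℤ) else 0) *
      (if G.Adj v w then (1 : ℤ) else 0)) = (Fintype.card (G.commonNeighbors u v) : ℤ) := by
    intro u v
    rw [← Set.toFinset_card, Finset.card_eq_sum_ones, Nat.cast_sum]
    have : (G.commonNeighbors u v).toFinset = univ.filter (fun w => G.Adj u w ∧ G.Adj v w) := by
      ext w; simp [SimpleGraph.mem_commonNeighbors]
    rw [this, Finset.sum_filter]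
    refine Finset.sum_congr rfl fun w _ => ?_
    by_cases h1 : G.Adj u w <;> by_cases h2 : G.Adj v w <;> simp [h1, h2]
  refine ⟨k, l, m, fun u v => ⟨fun e => ?_, fun e => ?_, fun e e' => ?_⟩⟩
  · subst e
    have := hG.regular u
    rw [← this, ← SimpleGraph.card_neighborFinset_eq_degree, SimpleGraph.neighborFinset_eq_filter,
      Finset.card_eq_sum_ones, Nat.cast_sum, Finset.sum_filter]
    refine Finset.sum_congr rfl fun w _ => ?_
    by_cases h1 : G.Adj u w <;> simp [h1]
  · beta_reduce; rw [key]; exact_mod_cast hG.of_adj u v e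
  · beta_reduce; rw [key]; exact_mod_cast hG.of_not_adj e e'

theorem sum_adj {n k l m : ℕ} (hG : G.IsSRGWith n k l m) (u : V) :
    ∑ w, (if G.Adj u w then (1 : ℤ) else 0) = k := by
  have := hG.regular u
  rw [← this, ← SimpleGraph.card_neighborFinset_eq_degree, SimpleGraph.neighborFinset_eq_filter,
      Finset.card_eq_sum_ones, Nat.cast_sum, Finset.sum_filter]
  refine Finset.sum_congr rfl fun w _ => ?_
  by_cases h1 : G.Adj u w <;> simp [h1]

theorem Coh.comp {n k l m : ℕ} (hG : G.IsSRGWith n k l m)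
    {f g : V → V → ℤ} (hf : Coh G f) (hg : Coh G g) :
    Coh G (fun u v => ∑ w, f u w * g v w) := by
  obtain ⟨a, b, c, h⟩ := hf.expand
  obtain ⟨a', b', c', h'⟩ := hg.expand
  have : (fun u v => ∑ w, f u w * g v w) = fun u v =>
      (a * a') * (if u = v then (1 : ℤ) else 0)
      + (a * b' + b * a') * (if G.Adj u v then (1 : ℤ) else 0)
      + (b * b') * (∑ w, (if G.Adj u w then (1 : ℤ) else 0) * (if G.Adj v w then (1 : ℤ) else 0))
      + (a * c' + c * a' + b * c' * k + c * b' * k + c * c' * Fintype.card V) := by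
    funext u v
    have e1 : ∀ w, f u w * g v w =
        (a * a') * ((if u = w then (1 : ℤ) else 0) * (if v = w then (1 : ℤ) else 0))
        + (a * b') * ((if u = w then (1 : ℤ) else 0) * (if G.Adj v w then (1 : ℤ) else 0))
        + (b * a') * ((if v = w then (1 : ℤ) else 0) * (if G.Adj u w then (1 : ℤ) else 0))
        + (b * b') * ((if G.Adj u w then (1 : ℤ) else 0) * (if G.Adj v w then (1 : ℤ) else 0))
        + (a * c') * (if u = w then (1 : ℤ) else 0)
        + (c * a') * (if v = w then (1 : ℤ) else 0)
        + (b * c') * (if G.Adj u w then (1 : ℤ) else 0)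
        + (c * b') * (if G.Adj v w then (1 : ℤ) else 0)
        + c * c' := by
      intro w; rw [h, h']; ring
    rw [Finset.sum_congr rfl fun w _ => e1 w]
    simp only [Finset.sum_add_distrib, ← Finset.mul_sum, sum_adj hG]
    have s1 : ∑ w, ((if u = w then (1 : ℤ) else 0) * (if v = w then (1 : ℤ) else 0))
        = if u = v then 1 else 0 := by
      simp
    have s2 : ∑ w, ((if u = w then (1 : ℤ) else 0) * (if G.Adj v w then (1 : ℤ) else 0))
        = if G.Adj u v then 1 else 0 := by
      simp only [ite_mul, one_mul, zero_mul, Finset.sum_ite_eq, Finset.mem_univ, if_true]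
      simp only [G.adj_comm]
    have s3 : ∑ w, ((if v = w then (1 : ℤ) else 0) * (if G.Adj u w then (1 : ℤ) else 0))
        = if G.Adj u v then 1 else 0 := by
      simp only [ite_mul, one_mul, zero_mul, Finset.sum_ite_eq, Finset.mem_univ, if_true]
    rw [s1, s2, s3]
    simp only [Finset.sum_ite_eq, Finset.mem_univ, if_true, Finset.sum_const, Finset.card_univ,
      nsmul_eq_mul]
    ring
  rw [this]
  exact ((((Coh.const _).mul coh_eq).add ((Coh.const _).mul coh_adj)).add
    ((Coh.const _).mul (coh_common hG))).add (Coh.const _)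

/-- Sum over the value of variable `v`. -/
def sumVar (v : ℕ) (T : (ℕ → V) → ℤ) : (ℕ → V) → ℤ :=
  fun φ => ∑ w, T (Function.update φ v w)

/-- Sum over the values of all variables of a list. -/
def sumVars : List ℕ → ((ℕ → V) → ℤ) → (ℕ → V) → ℤ
  | [], T => T
  | v :: vs, T => sumVars vs (sumVar v T)

theorem sumVar_comm (u v : ℕ) (T : (ℕ → V) → ℤ) :
    sumVar u (sumVar v T) = sumVar v (sumVar u T) := by
  by_cases h : u = v
  · rw [h]
  · funext φ
    simp only [sumVar]
    rw [Finset.sum_comm]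
    refine Finset.sum_congr rfl fun a _ => Finset.sum_congr rfl fun b _ => ?_
    rw [Function.update_comm h]

theorem sumVars_perm {vs us : List ℕ} (h : vs.Perm us) (T : (ℕ → V) → ℤ) :
    sumVars vs T = sumVars us T := by
  induction h generalizing T with
  | nil => rfl
  | cons x _ ih => exact ih _
  | swap x y l => simp only [sumVars]; rw [sumVar_comm]
  | trans _ _ ih1 ih2 => rw [ih1, ih2]

theorem sumVars_sub (vs : List ℕ) (T U : (ℕ → V) → ℤ) (φ : ℕ → V) :
    sumVars vs (fun φ => T φ - U φ) φ = sumVars vs T φ - sumVars vs U φ := by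
  induction vs generalizing T U with
  | nil => rfl
  | cons v vs ih =>
    simp only [sumVars]
    rw [← ih]
    congr 1
    funext φ
    simp [sumVar, Finset.sum_sub_distrib]

theorem sumVars_zero (vs : List ℕ) (φ : ℕ → V) :
    sumVars vs (fun _ => 0) φ = 0 := by
  have := sumVars_sub vs (fun _ : ℕ → V => 0) (fun _ => 0) φ
  simpa using this

/-- Product of binary factors. -/
def ev (L : List (ℕ × ℕ × (V → V → ℤ))) (φ : ℕ → V) : ℤ :=
  (L.map fun t => t.2.2 (φ t.1) (φ t.2.1)).prod

/-- A family of labelled factors with coherent labels, supported on `E`. -/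
def Supp (G : SimpleGraph V) (E : List (ℕ × ℕ)) (L : List (ℕ × ℕ × (V → V → ℤ))) : Prop :=
  ∀ t ∈ L, Coh G t.2.2 ∧ (t.1, t.2.1) ∈ E

def CohF (G : SimpleGraph V) (T : (ℕ → V) → ℤ) : Prop :=
  ∃ f, Coh G f ∧ ∀ φ, T φ = f (φ 0) (φ 1)

/-- Whether an edge is within `{v, i, j}` if it touches `v`. -/
def okEdge (v i j : ℕ) (e : ℕ × ℕ) : Bool :=
  if e.1 == v then (e.2 == i || e.2 == j || e.2 == v)
  else if e.2 == v then (e.1 == i || e.1 == j)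
  else true

def touches (v : ℕ) (e : ℕ × ℕ) : Bool := e.1 == v || e.2 == v

/-- The other endpoints of edges at `v`. -/
def nbrs (v : ℕ) (E : List (ℕ × ℕ)) : List ℕ :=
  (E.filter (touches v)).filterMap fun e =>
    if e.1 == v then (if e.2 == v then none else some e.2) else some e.1

def canElim (E : List (ℕ × ℕ)) (v : ℕ) : Option (ℕ × ℕ) :=
  match nbrs v E with
  | [] => if v == 0 then none else some (0, 0)
  | i :: r =>
    let j := (r.find? (fun j => !(j == i))).getD i
    if E.all (okEdge v i j) && !(i == v) && !(j == v) then some (i, j) else none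

/-- First variable that can be eliminated. -/
def pick (E : List (ℕ × ℕ)) : List ℕ → Option (ℕ × ℕ × ℕ)
  | [] => none
  | v :: vs => match canElim E v with
    | some (i, j) => some (v, i, j)
    | none => pick E vs

def elim : ℕ → List ℕ → List (ℕ × ℕ) → Bool
  | _, [], E => E.all fun e => (e.1 == 0 || e.1 == 1) && (e.2 == 0 || e.2 == 1)
  | 0, _ :: _, _ => false
  | k + 1, vs, E =>
    match pick E vs with
    | none => false
    | some (v, i, j) =>
      vs.contains v && E.all (okEdge v i j) && !(i == v) && !(j == v) &&
        elim k (vs.erase v) ((i, j) :: E.filter fun e => !(touches v e))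

def ren (i j : ℕ) (a : ℕ) : ℕ := if a == i then j else a

def check : ℕ → List ℕ → List (ℕ × ℕ) → List (ℕ × ℕ) → Bool
  | _, vs, E, [] => elim vs.length vs E
  | 0, _, _, _ :: _ => false
  | k + 1, vs, E, (i, j) :: D =>
    if i == j then true
    else if E.contains (i, j) || E.contains (j, i) then check k vs E D
    else check k vs E D &&
      check k vs ((i, j) :: E.map fun e => (ren i j e.1, ren i j e.2))
        (D.map fun e => (ren i j e.1, ren i j e.2))

def pairs : ℕ → List (ℕ × ℕ)
  | 0 => []
  | k + 1 => (List.range k).map (fun j => (k, j)) ++ pairs k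


def es (s : ℕ) : List (ℕ × ℕ) := ((List.range (s - 2)).map fun i => (i + 1, i + 2)) ++ [(s - 1, 0)]

def vars (s : ℕ) : List ℕ := ((List.range (s - 2)).map (· + 2)).reverse

theorem check_all : ∀ s ∈ List.range 8, check 40 (vars s) ((0, 1) :: es s) (pairs s) = true := by
  decide +kernel

theorem ev_cons (t : ℕ × ℕ × (V → V → ℤ)) (L : List (ℕ × ℕ × (V → V → ℤ))) (φ : ℕ → V) :
    ev (t :: L) φ = t.2.2 (φ t.1) (φ t.2.1) * ev L φ := by
  simp [ev]

theorem CohF.mul {T U : (ℕ → V) → ℤ} (hT : CohF G T) (hU : CohF G U) :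
    CohF G (fun φ => T φ * U φ) := by
  obtain ⟨f, hf, h⟩ := hT
  obtain ⟨g, hg, h'⟩ := hU
  exact ⟨_, hf.mul hg, fun φ => by simp only [h, h']⟩

theorem CohF.sub {T U : (ℕ → V) → ℤ} (hT : CohF G T) (hU : CohF G U) :
    CohF G (fun φ => T φ - U φ) := by
  obtain ⟨f, hf, h⟩ := hT
  obtain ⟨g, hg, h'⟩ := hU
  exact ⟨_, hf.sub hg, fun φ => by simp only [h, h']⟩

theorem cohF_base (E : List (ℕ × ℕ))
    (hE : (E.all fun e => (e.1 == 0 || e.1 == 1) && (e.2 == 0 || e.2 == 1)) = true)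
    (L : List (ℕ × ℕ × (V → V → ℤ))) (hL : Supp G E L) : CohF G (ev L) := by
  induction L with
  | nil => exact ⟨_, Coh.const 1, fun φ => by simp [ev]⟩
  | cons t L ih =>
    have h1 := ih (fun t ht => hL t (List.mem_cons_of_mem _ ht))
    obtain ⟨hc, hm⟩ := hL t List.mem_cons_self
    have h2 := List.all_eq_true.1 hE _ hm
    simp only [Bool.and_eq_true, Bool.or_eq_true, beq_iff_eq] at h2
    obtain ⟨i, j, f⟩ := t
    have h3 : CohF G (fun φ : ℕ → V => f (φ i) (φ j)) := by
      obtain ⟨a, ha⟩ := hc.diag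
      dsimp only at h2 ha hc
      rcases h2 with ⟨rfl | rfl, rfl | rfl⟩
      · exact ⟨_, Coh.const a, fun φ => ha _⟩
      · exact ⟨f, hc, fun φ => rfl⟩
      · exact ⟨f, hc, fun φ => hc.symm _ _⟩
      · exact ⟨_, Coh.const a, fun φ => ha _⟩
    have := h3.mul h1
    obtain ⟨g, hg, h⟩ := this
    exact ⟨g, hg, fun φ => by rw [ev_cons, ← h]⟩

theorem ev_split (v i j : ℕ) (hi : i ≠ v) (hj : j ≠ v) (E : List (ℕ × ℕ))
    (hE : E.all (okEdge v i j) = true) (L : List (ℕ × ℕ × (V → V → ℤ))) (hL : Supp G E L) :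
    ∃ f g L', Coh G f ∧ Coh G g ∧ Supp G (E.filter fun e => !(touches v e)) L' ∧
      ∀ φ w, ev L (Function.update φ v w) = f (φ i) w * g (φ j) w * ev L' φ := by
  induction L with
  | nil =>
    exact ⟨_, _, [], Coh.const 1, Coh.const 1, by simp [Supp], fun φ w => by simp [ev]⟩
  | cons t L ih =>
    obtain ⟨f, g, L', hf, hg, hL', h⟩ := ih (fun t ht => hL t (List.mem_cons_of_mem _ ht))
    obtain ⟨hc, hm⟩ := hL t List.mem_cons_self
    have h2 := List.all_eq_true.1 hE _ hm
    obtain ⟨p, q, k⟩ := t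
    dsimp only at hc hm h2
    have hcase : (p = v ∧ q = v) ∨ (p = v ∧ q = i) ∨ (p = v ∧ q = j) ∨ (p = i ∧ q = v) ∨
        (p = j ∧ q = v) ∨ (p ≠ v ∧ q ≠ v) := by
      unfold okEdge at h2
      by_cases e1 : p = v <;> by_cases e2 : q = v <;> simp_all
    rcases hcase with ⟨rfl, rfl⟩ | ⟨rfl, rfl⟩ | ⟨rfl, rfl⟩ | ⟨rfl, rfl⟩ | ⟨rfl, rfl⟩ | ⟨e1, e2⟩
    · obtain ⟨a, ha⟩ := hc.diag
      refine ⟨_, g, L', (Coh.const a).mul hf, hg, hL', fun φ w => ?_⟩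
      rw [ev_cons, h]
      simp only [Function.update_self, ha]
      ring
    · refine ⟨_, g, L', hc.mul hf, hg, hL', fun φ w => ?_⟩
      rw [ev_cons, h]
      simp only [Function.update_self, Function.update_of_ne hi]
      rw [hc.symm]; ring
    · refine ⟨f, _, L', hf, hc.mul hg, hL', fun φ w => ?_⟩
      rw [ev_cons, h]
      simp only [Function.update_self, Function.update_of_ne hj]
      rw [hc.symm]; ring
    · refine ⟨_, g, L', hc.mul hf, hg, hL', fun φ w => ?_⟩
      rw [ev_cons, h]
      simp only [Function.update_self, Function.update_of_ne hi]
      ring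
    · refine ⟨f, _, L', hf, hc.mul hg, hL', fun φ w => ?_⟩
      rw [ev_cons, h]
      simp only [Function.update_self, Function.update_of_ne hj]
      ring
    · refine ⟨f, g, (p, q, k) :: L', hf, hg, ?_, fun φ w => ?_⟩
      · intro t ht
        rcases List.mem_cons.1 ht with rfl | ht
        · refine ⟨hc, List.mem_filter.2 ⟨hm, ?_⟩⟩
          simp [touches, e1, e2]
        · exact hL' t ht
      · rw [ev_cons, h, ev_cons]
        simp only [Function.update_of_ne e1, Function.update_of_ne e2]
        ring

theorem elim_sound {n k l m : ℕ} (hG : G.IsSRGWith n k l m) (fuel : ℕ) (vs : List ℕ)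
    (E : List (ℕ × ℕ)) (h : elim fuel vs E = true) (L : List (ℕ × ℕ × (V → V → ℤ)))
    (hL : Supp G E L) : CohF G (sumVars vs (ev L)) := by
  induction fuel generalizing vs E L with
  | zero =>
    cases vs with
    | nil => exact cohF_base E (by simpa [elim] using h) L hL
    | cons v vs => simp [elim] at h
  | succ fuel ih =>
    cases vs with
    | nil => exact cohF_base E (by simpa [elim] using h) L hL
    | cons u us =>
      rw [elim] at h
      · generalize hvs : u :: us = vs at h
        split at h
        · exact absurd h (by simp)
        · rename_i v i j _
          simp only [Bool.and_eq_true, Bool.not_eq_true', beq_eq_false_iff_ne, ne_eq,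
            List.contains_iff_mem] at h
          obtain ⟨⟨⟨⟨hv, hE⟩, hi⟩, hj⟩, hr⟩ := h
          obtain ⟨f, g, L', hf, hg, hL', hev⟩ := ev_split v i j hi hj E hE L hL
          rw [sumVars_perm (List.perm_cons_erase hv)]
          have hs : sumVar v (ev L) = ev ((i, j, fun a b => ∑ w, f a w * g b w) :: L') := by
            funext φ
            rw [ev_cons]
            simp only [sumVar, hev, Finset.sum_mul]
          simp only [sumVars, hs]
          refine ih _ _ hr _ ?_
          intro t ht
          rcases List.mem_cons.1 ht with rfl | ht
          · exact ⟨hf.comp hG hg, List.mem_cons_self⟩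
          · exact ⟨(hL' t ht).1, List.mem_cons_of_mem _ (hL' t ht).2⟩
      · simp

/-- Indicator of a list of disequalities. -/
def dd (D : List (ℕ × ℕ)) (φ : ℕ → V) : ℤ := if ∀ d ∈ D, φ d.1 ≠ φ d.2 then 1 else 0

theorem dd_cons (d : ℕ × ℕ) (D : List (ℕ × ℕ)) (φ : ℕ → V) :
    dd (d :: D) φ = (if φ d.1 ≠ φ d.2 then 1 else 0) * dd D φ := by
  unfold dd
  by_cases h1 : φ d.1 = φ d.2
  · simp [h1]
  · simp only [List.forall_mem_cons, ne_eq, h1, not_false_eq_true, true_and, if_true, one_mul]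

theorem check_sound {n k l m : ℕ} (hG : G.IsSRGWith n k l m) (fuel : ℕ) (vs : List ℕ)
    (E D : List (ℕ × ℕ)) (h : check fuel vs E D = true) (L : List (ℕ × ℕ × (V → V → ℤ)))
    (hL : Supp G E L) : CohF G (sumVars vs (fun φ => ev L φ * dd D φ)) := by
  induction fuel generalizing E D L with
  | zero =>
    cases D with
    | nil =>
      simp only [check] at h
      simpa [dd] using elim_sound hG _ _ _ h L hL
    | cons d D => simp [check] at h
  | succ fuel ih =>
    cases D with
    | nil =>
      simp only [check] at h
      simpa [dd] using elim_sound hG _ _ _ h L hL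
    | cons d D =>
      obtain ⟨i, j⟩ := d
      simp only [check, beq_iff_eq] at h
      split_ifs at h with h1 h2
      · subst h1
        refine ⟨_, Coh.const 0, fun φ => ?_⟩
        rw [← sumVars_zero vs φ]
        congr 1
        funext φ
        simp [dd]
      · simp only [Bool.or_eq_true, List.contains_iff_mem] at h2
        rcases h2 with h2 | h2
        · have := ih E D h ((i, j, fun u v => if u ≠ v then (1 : ℤ) else 0) :: L) (by
            intro t ht
            rcases List.mem_cons.1 ht with rfl | ht
            · exact ⟨coh_ne, h2⟩
            · exact hL t ht)
          convert this using 3 with φ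
          rw [ev_cons, dd_cons]
          ring
        · have := ih E D h ((j, i, fun u v => if u ≠ v then (1 : ℤ) else 0) :: L) (by
            intro t ht
            rcases List.mem_cons.1 ht with rfl | ht
            · exact ⟨coh_ne, h2⟩
            · exact hL t ht)
          convert this using 3 with φ
          rw [ev_cons, dd_cons]
          simp only [ne_comm (a := φ i)]
          ring
      · simp only [Bool.and_eq_true] at h
        have c1 := ih E D h.1 L hL
        have c2 := ih _ _ h.2 ((i, j, fun u v => if u = v then (1 : ℤ) else 0) ::
            L.map (fun t => (ren i j t.1, ren i j t.2.1, t.2.2))) (by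
          intro t ht
          rcases List.mem_cons.1 ht with rfl | ht
          · exact ⟨coh_eq, List.mem_cons_self⟩
          · obtain ⟨t', ht', rfl⟩ := List.mem_map.1 ht
            refine ⟨(hL t' ht').1, List.mem_cons_of_mem _ (List.mem_map.2 ⟨_, (hL t' ht').2, rfl⟩)⟩)
        have c3 := c1.sub c2
        obtain ⟨f, hf, hh⟩ := c3
        refine ⟨f, hf, fun φ => ?_⟩
        rw [← hh]
        beta_reduce
        rw [← sumVars_sub]
        congr 1
        funext φ
        rw [ev_cons, dd_cons]
        by_cases e : φ i = φ j
        · have hr : ∀ a, φ (ren i j a) = φ a := by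
            intro a
            unfold ren
            by_cases ea : a = i
            · simp [ea, e]
            · simp [ea]
          have e1 : ev (L.map (fun t => (ren i j t.1, ren i j t.2.1, t.2.2))) φ = ev L φ := by
            simp [ev, Function.comp_def, hr]
          have e2 : dd (D.map fun e => (ren i j e.1, ren i j e.2)) φ = dd D φ := by
            simp only [dd, List.forall_mem_map, hr]
          rw [e1, e2]
          simp [e]
        · simp [e]

/-- Sum over walks of a function of the support. -/
def wS (G : SimpleGraph V) [DecidableRel G.Adj] : ℕ → V → V → (List V → ℤ) → ℤ
  | 0, u, v, F => if u = v then F [u] else 0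
  | m + 1, u, v, F => ∑ w, if G.Adj u w then wS G m w v (fun p => F (u :: p)) else 0

theorem sum_walks (m : ℕ) (u v : V) (F : List V → ℤ) :
    ∑ p ∈ G.finsetWalkLength m u v, F p.support = wS G m u v F := by
  induction m generalizing u F with
  | zero =>
    by_cases h : u = v
    · subst h; simp [SimpleGraph.finsetWalkLength, wS]
    · simp [SimpleGraph.finsetWalkLength, wS, h]
  | succ m ih =>
    rw [SimpleGraph.finsetWalkLength, Finset.sum_biUnion]
    · simp only [Finset.sum_map, wS]
      change ∑ w : G.neighborSet u, ∑ p ∈ G.finsetWalkLength m (w : V) v, F (u :: p.support) = _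
      rw [← Finset.sum_filter]
      have : ∀ w : G.neighborSet u, ∑ p ∈ G.finsetWalkLength m (w : V) v, F (u :: p.support)
          = wS G m (w : V) v (fun p => F (u :: p)) := fun w => ih (w : V) (fun p => F (u :: p))
      rw [Finset.sum_congr rfl fun w _ => this w]
      exact (Finset.sum_subtype (univ.filter fun w => G.Adj u w) (by simp)
        (fun w => wS G m w v (fun p => F (u :: p)))).symm
    · intro a _ b _ hab
      rw [Function.onFun, Finset.disjoint_left]
      intro p hp hp'
      simp only [Finset.mem_map] at hp hp'
      obtain ⟨q, _, rfl⟩ := hp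
      obtain ⟨q', _, h⟩ := hp'
      apply hab
      have := congrArg (fun w => w.getVert 1) h
      change q'.getVert 0 = q.getVert 0 at this
      rw [SimpleGraph.Walk.getVert_zero, SimpleGraph.Walk.getVert_zero] at this
      exact Subtype.ext this.symm

theorem card_cycles {x y : V} (h : G.Adj x y) (s : ℕ) (hs : 2 ≤ s) :
    (Nat.card {w : G.Walk x x // w.IsCycle ∧ w.length = s + 1 ∧ w.getVert 1 = y} : ℤ) =
      wS G s y x (fun p => if p.Nodup then 1 else 0) := by
  rw [← sum_walks, Finset.sum_boole, Nat.cast_inj]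
  symm
  rw [← Nat.card_eq_finsetCard]
  refine Nat.card_congr (Equiv.ofBijective
    (fun p => ⟨SimpleGraph.Walk.cons h p.1, ?_, ?_, ?_⟩) ⟨?_, ?_⟩)
  · have hp := p.2
    rw [Finset.mem_filter, SimpleGraph.mem_finsetWalkLength_iff] at hp
    rw [SimpleGraph.Walk.isCycle_iff_isPath_tail_and_le_length]
    refine ⟨?_, by rw [SimpleGraph.Walk.length_cons]; omega⟩
    simpa [SimpleGraph.Walk.isPath_def] using hp.2
  · have hp := p.2
    rw [Finset.mem_filter, SimpleGraph.mem_finsetWalkLength_iff] at hp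
    simp [hp.1]
  · simp
  · intro p q hpq
    have h1 := congrArg Subtype.val hpq
    change SimpleGraph.Walk.cons h p.1 = SimpleGraph.Walk.cons h q.1 at h1
    exact Subtype.ext (by simpa using h1)
  · rintro ⟨w, hw, hl, hy⟩
    cases w with
    | nil => simp at hl
    | cons h' p =>
      simp at hy
      subst hy
      refine ⟨⟨p, ?_⟩, rfl⟩
      rw [Finset.mem_filter, SimpleGraph.mem_finsetWalkLength_iff]
      refine ⟨by simpa using hl, ?_⟩
      exact ((SimpleGraph.Walk.cons_isCycle_iff _ _).1 hw).1.support_nodup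

/-- The factors of the cycle count. -/
def facs (G : SimpleGraph V) [DecidableRel G.Adj] (s : ℕ) : List (ℕ × ℕ × (V → V → ℤ)) :=
  (es s).map fun e => (e.1, e.2, fun u v => if G.Adj u v then (1 : ℤ) else 0)

theorem final_coh {n k l m : ℕ} (hG : G.IsSRGWith n k l m) (s : ℕ) (hs : s ≤ 7) :
    CohF G (sumVars (vars s) (fun φ => ev (facs G s) φ * dd (pairs s) φ)) := by
  refine check_sound hG 40 _ _ _ (check_all s (by simp; omega)) _ ?_
  intro t ht
  obtain ⟨e, he, rfl⟩ := List.mem_map.1 ht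
  exact ⟨coh_adj, List.mem_cons_of_mem _ he⟩

/-- The assignment with `0 ↦ x` and everything else sent to `y`. -/
def asg (x y : V) : ℕ → V := fun i => if i = 0 then x else y

theorem wS_eq (x y : V) (s : ℕ) (h3 : 3 ≤ s) (h7 : s ≤ 7) :
    wS G (s - 1) y x (fun p => if p.Nodup then 1 else 0) =
      sumVars (vars s) (fun φ => ev (facs G s) φ * dd (pairs s) φ) (asg x y) := by
  have hsum : ∀ (c : Prop) [Decidable c] (f : V → ℤ),
      (if c then ∑ w, f w else 0) = ∑ w, if c then f w else 0 := by
    intro c _ f; split_ifs <;> simp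
  have hx : ∀ (u : V) (z : V → ℤ), (∑ w, if G.Adj u w then (if w = x then z w else 0) else 0)
      = if G.Adj u x then z x else 0 := by
    intro u z
    rw [Finset.sum_eq_single x]
    · simp
    · intro b _ hb; simp [hb]
    · simp
  have hite : ∀ (c : Prop) [Decidable c] (a b : ℤ), a = b →
      (if c then a else 0) = if c then b else 0 := by
    intro c _ a b h; rw [h]
  interval_cases s
  all_goals
    simp only [wS, hx, Nat.reduceSub]
    simp +decide only [hsum, vars, sumVars, sumVar, facs, es, ev, List.range,
      List.range.loop, List.map, List.reverse, List.reverseAux, List.prod_cons, List.prod_nil,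
      mul_one, asg, Function.update_self, Function.update_of_ne, ne_eq,
      Nat.reduceAdd, Nat.reduceSub, zero_add, List.append,
      if_true, if_false, ite_mul, one_mul, zero_mul, HAppend.hAppend, Append.append]
    repeat' refine Finset.sum_congr rfl fun _ _ => ?_
    iterate 10 try refine hite (G.Adj _ _) _ _ ?_
    unfold dd
    refine if_congr ?_ rfl rfl
    simp +decide only [pairs, List.range, List.range.loop, List.map, List.append, HAppend.hAppend,
      Append.append, List.forall_mem_cons, Function.update_self, Function.update_of_ne, ne_eq, asg,
      if_true, if_false]
    simp only [List.nodup_cons, List.mem_cons, List.not_mem_nil, not_or, List.nodup_nil, and_true,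
      or_false, false_imp_iff, implies_true, not_false_eq_true]
    clear hsum hx hite
    grind

end main
end SrgCycle

/-- In a strongly regular graph `G`, for every `3 ≤ s ≤ 7` and
any two edges `xy` and `x'y'`, the number of `s`-cycles containing the edge `xy`
equals the number of `s`-cycles containing the edge `x'y'`. -/
theorem srg_cycle_through_edge_count_invariant {V : Type*} [Fintype V]
    (G : SimpleGraph V) [DecidableRel G.Adj] (n k l m : ℕ)
    (hG : G.IsSRGWith n k l m) :
    ∀ s : ℕ, 3 ≤ s → s ≤ 7 → ∀ x y x' y' : V, G.Adj x y → G.Adj x' y' →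
      Nat.card {w : G.Walk x x // w.IsCycle ∧ w.length = s ∧ w.getVert 1 = y} =
      Nat.card {w : G.Walk x' x' // w.IsCycle ∧ w.length = s ∧ w.getVert 1 = y'} := by
  classical
  intro s h3 h7 x y x' y' h h'
  obtain ⟨f, ⟨a, b, c, hf⟩, hF⟩ := SrgCycle.final_coh hG s h7
  have key : ∀ x y : V, G.Adj x y →
      (Nat.card {w : G.Walk x x // w.IsCycle ∧ w.length = s ∧ w.getVert 1 = y} : ℤ) = b := by
    intro x y h
    have h1 := SrgCycle.card_cycles h (s - 1) (by omega)
    rw [Nat.sub_add_cancel (by omega)] at h1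
    rw [h1, SrgCycle.wS_eq x y s h3 h7, hF]
    exact (hf x y).2.1 h
  have := (key x y h).trans (key x' y' h').symm
  exact_mod_cast this
end

section
/- Let G be a finite simple graph with vertex set V. The initial WL2 coloring of pairs is already stable, i.e., for all pairs p, q ∈ V × V, R_0 p q implies R_1 p q, if and only if there exist natural numbers k, λ, μ such that G is strongly regular with parameters (Fintype.card V, k, λ, μ). -/
/-- The iterated 2-dimensional Weisfeiler-Leman equivalence relations `R_i` on
pairs of vertices of a simple graph `G`. -/
def wlRel {V : Type*} (G : SimpleGraph V) : ℕ → V × V → V × V → Prop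
  | 0, p, q => ((p.1 = p.2) ↔ (q.1 = q.2)) ∧ (G.Adj p.1 p.2 ↔ G.Adj q.1 q.2)
  | i + 1, p, q => wlRel G i p q ∧ ∀ uv u'v' : V × V,
      Nat.card {z : V // wlRel G i (p.1, z) uv ∧ wlRel G i (z, p.2) u'v'} =
      Nat.card {z : V // wlRel G i (q.1, z) uv ∧ wlRel G i (z, q.2) u'v'}

open Classical in
/-- The indicator of an `R_0` class is an affine combination of the equality and
adjacency indicators. -/
lemma ind_affine {V : Type*} (G : SimpleGraph V) (p : V × V) :
    ∃ α β γ : ℤ, ∀ x z : V, (if wlRel G 0 (x, z) p then (1 : ℤ) else 0) =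
      α + β * (if x = z then 1 else 0) + γ * (if G.Adj x z then 1 else 0) := by
  by_cases h : p.1 = p.2
  · have h2 : ¬ G.Adj p.1 p.2 := by rw [h]; exact G.irrefl
    refine ⟨0, 1, 0, fun x z => ?_⟩
    by_cases hx : x = z
    · subst hx; simp [wlRel, h]
    · simp [wlRel, h, hx]
  · by_cases h2 : G.Adj p.1 p.2
    · refine ⟨0, 0, 1, fun x z => ?_⟩
      by_cases hx : x = z
      · subst hx; simp [wlRel, h]
      · simp [wlRel, h, hx, h2]
    · refine ⟨1, -1, -1, fun x z => ?_⟩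
      by_cases hx : x = z
      · subst hx; simp [wlRel, h]
      · by_cases ha : G.Adj x z <;> simp [wlRel, h, hx, h2, ha]

open Classical in
lemma card_eq_sum {V : Type*} [Fintype V] (P Q : V → Prop) :
    ((Nat.card {z : V // P z ∧ Q z} : ℕ) : ℤ) =
      ∑ z, (if P z then (1 : ℤ) else 0) * (if Q z then 1 else 0) := by
  rw [Nat.card_eq_fintype_card, Fintype.card_subtype, Finset.card_filter]
  push_cast
  refine Finset.sum_congr rfl fun z _ => ?_
  by_cases h : P z <;> by_cases h' : Q z <;> simp [h, h']

lemma nat_card_common {V : Type*} [Fintype V] (G : SimpleGraph V) [DecidableRel G.Adj]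
    (x y : V) : Nat.card {z : V // G.Adj x z ∧ G.Adj z y} =
      Fintype.card (G.commonNeighbors x y) := by
  rw [← Nat.card_eq_fintype_card]
  refine Nat.card_congr (Equiv.subtypeEquivRight fun z => ?_)
  rw [SimpleGraph.mem_commonNeighbors, G.adj_comm z y]

lemma nat_card_self {V : Type*} [Fintype V] (G : SimpleGraph V) [DecidableRel G.Adj]
    (x : V) : Nat.card {z : V // G.Adj x z ∧ G.Adj z x} = G.degree x := by
  rw [← SimpleGraph.card_neighborSet_eq_degree, ← Nat.card_eq_fintype_card]
  refine Nat.card_congr (Equiv.subtypeEquivRight fun z => ?_)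
  rw [SimpleGraph.mem_neighborSet, G.adj_comm z x, and_self]

lemma wlRel_zero_adj {V : Type*} (G : SimpleGraph V) {u v : V} (h : G.Adj u v) (x z : V) :
    wlRel G 0 (x, z) (u, v) ↔ G.Adj x z := by
  have := h.ne
  simp only [wlRel, h, iff_true, this, iff_false]
  exact ⟨fun h => h.2, fun h => ⟨h.ne, h⟩⟩

open Classical in
lemma sum_expand {V : Type*} [Fintype V] (G : SimpleGraph V) (k : ℕ)
    (hk : ∀ x, ∑ z, (if G.Adj x z then (1 : ℤ) else 0) = k) (x y : V)
    (α β γ α' β' γ' : ℤ) :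
    ∑ z, (α + β * (if x = z then 1 else 0) + γ * (if G.Adj x z then 1 else 0)) *
      (α' + β' * (if z = y then 1 else 0) + γ' * (if G.Adj z y then 1 else 0)) =
    α * α' * Fintype.card V + α * β' + α * γ' * k + β * α' +
      β * β' * (if x = y then 1 else 0) + β * γ' * (if G.Adj x y then 1 else 0) +
      γ * α' * k + γ * β' * (if G.Adj x y then 1 else 0) +
      γ * γ' * (Nat.card {z : V // G.Adj x z ∧ G.Adj z y} : ℕ) := by
  have hk' : ∑ z, (if G.Adj z y then (1 : ℤ) else 0) = k := by
    rw [← hk y]; simp only [G.adj_comm y]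
  have e1 : ∑ z, (if x = z then (1 : ℤ) else 0) = 1 := by simp
  have e2 : ∑ z, (if z = y then (1 : ℤ) else 0) = 1 := by simp
  have e3 : ∑ z, (if x = z then (1 : ℤ) else 0) * (if z = y then 1 else 0) =
    if x = y then 1 else 0 := by simp
  have e4 : ∑ z, (if x = z then (1 : ℤ) else 0) * (if G.Adj z y then 1 else 0) =
    if G.Adj x y then 1 else 0 := by simp only [ite_mul, one_mul, zero_mul, Finset.sum_ite_eq, Finset.mem_univ, if_true]
  have e5 : ∑ z, (if G.Adj x z then (1 : ℤ) else 0) * (if z = y then 1 else 0) =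
    if G.Adj x y then 1 else 0 := by simp
  have e0 : ∑ _z : V, (1 : ℤ) = Fintype.card V := by simp
  rw [card_eq_sum, ← e3]
  nth_rewrite 1 [← e4]
  rw [← e5, ← e0]
  have : ∀ a b c d e f g : ℤ, a + α * β' + α * γ' * k + β * α' + b + c + γ * α' * k + d + e =
    a + α * β' * (∑ z, (if z = y then (1 : ℤ) else 0)) +
      α * γ' * (∑ z, (if G.Adj z y then (1 : ℤ) else 0)) +
      β * α' * (∑ z, (if x = z then (1 : ℤ) else 0)) + b + c +
      γ * α' * (∑ z, (if G.Adj x z then (1 : ℤ) else 0)) + d + e := by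
    intros; rw [e1, e2, hk, hk']; ring
  rw [this _ _ _ _ _ 0 0]
  simp only [Finset.mul_sum, ← Finset.sum_add_distrib]
  refine Finset.sum_congr rfl fun z _ => ?_
  ring

/-- The initial WL2 coloring of a finite graph `G` is already
stable (`R_0` implies `R_1`) if and only if `G` is strongly regular with some
parameters. -/
theorem wl_stable_iff_srg {V : Type*} [Fintype V]
    (G : SimpleGraph V) [DecidableRel G.Adj] :
    (∀ p q : V × V, wlRel G 0 p q → wlRel G 1 p q) ↔
      ∃ k l m : ℕ, G.IsSRGWith (Fintype.card V) k l m := by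
  classical
  constructor
  · intro H
    by_cases hE : ∃ u v, G.Adj u v
    · obtain ⟨u, v, huv⟩ := hE
      have key : ∀ p q : V × V, wlRel G 0 p q →
          Nat.card {z : V // G.Adj p.1 z ∧ G.Adj z p.2} =
          Nat.card {z : V // G.Adj q.1 z ∧ G.Adj z q.2} := by
        intro p q h
        have h1 := (H p q h).2 (u, v) (u, v)
        simpa only [wlRel_zero_adj G huv] using h1
      have hm : ∃ m, ∀ x y, x ≠ y → ¬ G.Adj x y →
          Fintype.card (G.commonNeighbors x y) = m := by
        by_cases hN : ∃ a b, a ≠ b ∧ ¬ G.Adj a b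
        · obtain ⟨a, b, hab, hn⟩ := hN
          refine ⟨Fintype.card (G.commonNeighbors a b), fun x y hxy hn' => ?_⟩
          rw [← nat_card_common, ← nat_card_common]
          exact key (x, y) (a, b) (by simp [wlRel, hab, hn, hxy, hn'])
        · push Not at hN
          exact ⟨0, fun x y hxy hn => absurd (hN x y hxy) hn⟩
      obtain ⟨m, hm⟩ := hm
      refine ⟨G.degree u, Fintype.card (G.commonNeighbors u v), m, rfl, ?_, ?_, ?_⟩
      · intro x
        rw [← nat_card_self, ← nat_card_self]
        exact key (x, x) (u, u) (by simp [wlRel])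
      · intro x y hxy
        rw [← nat_card_common, ← nat_card_common]
        exact key (x, y) (u, v) (by simp [wlRel, hxy, huv, hxy.ne, huv.ne])
      · intro x y hxy hn
        exact hm x y hxy hn
    · push Not at hE
      refine ⟨0, 0, 0, rfl, ?_, fun x y h => absurd h (hE x y), ?_⟩
      · intro x
        rw [← nat_card_self]
        simp [hE]
      · intro x y _ _
        rw [← nat_card_common]
        simp [hE]
  · rintro ⟨k, l, m, hG⟩ p q h
    refine ⟨h, fun a b => ?_⟩
    obtain ⟨α, β, γ, h1⟩ := ind_affine G a
    obtain ⟨α', β', γ', h2⟩ := ind_affine G b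
    have hk : ∀ x, ∑ z, (if G.Adj x z then (1 : ℤ) else 0) = k := by
      intro x
      rw [← hG.regular x, ← nat_card_self, card_eq_sum]
      refine Finset.sum_congr rfl fun z _ => ?_
      by_cases hx : G.Adj x z <;> simp [hx, G.adj_comm z x]
    have hc : ∀ x y, Nat.card {z : V // G.Adj x z ∧ G.Adj z y} =
        if x = y then k else if G.Adj x y then l else m := by
      intro x y
      by_cases hxy : x = y
      · subst hxy
        rw [nat_card_self, hG.regular x]; simp
      · rw [nat_card_common]
        by_cases ha : G.Adj x y
        · rw [hG.of_adj x y ha]; simp [hxy, ha]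
        · rw [hG.of_not_adj hxy ha]; simp [hxy, ha]
    zify
    rw [card_eq_sum, card_eq_sum]
    simp only [h1, h2]
    have hk2 := sum_expand G k (fun x => by convert hk x)
    rw [hk2, hk2, hc, hc]
    obtain ⟨h3, h4⟩ := h
    by_cases h5 : q.1 = q.2 <;> by_cases h6 : G.Adj q.1 q.2 <;>
      simp [h3, h4, h5, h6]
end

section
/- There exist natural numbers n, k, λ, μ, a finite simple graph G that is strongly regular with parameters (n, k, λ, μ), and vertices x, y, x', y' of G with x ≠ y, x' ≠ y', x not adjacent to y, and x' not adjacent to y', such that the number of paths on 8 vertices from x to y differs from the number of paths on 8 vertices from x' to y'. (Hence the bound ℓ ≤ 7 in the invariance of path counts between vertex pairs in strongly regular graphs is optimal; a witness is the Shrikhande graph.) -/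
namespace SrgPath

/-- Neighbours of a vertex in the Shrikhande graph; `i` encodes `(i / 4, i % 4)` in `(ℤ/4)²`. -/
def nb : ℕ → List ℕ
  | i => [(i / 4) * 4 + (i + 1) % 4, (i / 4) * 4 + (i + 3) % 4, (i + 4) % 16, (i + 12) % 16,
      ((i + 4) % 16 / 4) * 4 + (i + 1) % 4, ((i + 12) % 16 / 4) * 4 + (i + 3) % 4]

/-- The Shrikhande graph. -/
def shr : SimpleGraph (Fin 16) where
  Adj i j := j.val ∈ nb i.val
  symm := ⟨by unfold nb; decide⟩
  loopless := ⟨by unfold nb; decide⟩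

instance : DecidableRel shr.Adj := fun i j => inferInstanceAs (Decidable (j.val ∈ nb i.val))

/-- Counts paths from `u` to `v` with `n` edges avoiding the vertices in the bit mask `S`. -/
def cnt (v : ℕ) (n : ℕ) : ℕ → ℕ → ℕ :=
  Nat.rec (fun S u => bif Nat.testBit S u then 0 else bif Nat.beq u v then 1 else 0)
    (fun _ ih S u => bif Nat.testBit S u then 0 else
      bif Nat.beq u v then 0 else
        ((nb u).map (ih (S ||| (1 <<< u)))).sum) n

/-- Paths with `n` edges avoiding the mask `S`. -/
abbrev Good (v : Fin 16) (n S : ℕ) (u : Fin 16) : Type :=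
  {p : shr.Walk u v // p.IsPath ∧ p.length = n ∧ ∀ w ∈ p.support, S.testBit w.val = false}

instance (v : Fin 16) (n S : ℕ) (u : Fin 16) : Finite (Good v n S u) := by
  have : Finite {p : shr.Walk u v // p.length = n} :=
    inferInstanceAs (Finite {p : shr.Walk u v | p.length = n})
  exact Finite.of_injective
    (fun p : Good v n S u => (⟨p.1, p.2.2.1⟩ : {p : shr.Walk u v // p.length = n}))
    (by rintro ⟨p, hp⟩ ⟨q, hq⟩ h; simpa using h)

lemma mask (S : ℕ) (u w : Fin 16) :
    (S ||| (1 <<< u.val)).testBit w.val = false ↔ S.testBit w.val = false ∧ w ≠ u := by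
  rw [Nat.testBit_or, Nat.one_shiftLeft, Nat.testBit_two_pow, Bool.or_eq_false_iff]
  rw [decide_eq_false_iff_not, ne_eq, Fin.ext_iff, eq_comm (a := u.val)]

/-- Prepending the first edge. -/
def join (v : Fin 16) (n S : ℕ) (u : Fin 16) (hu : S.testBit u.val = false)
    (q : Σ z : {z // shr.Adj u z}, Good v n (S ||| (1 <<< u.val)) z.1) : Good v (n + 1) S u :=
  ⟨SimpleGraph.Walk.cons q.1.2 q.2.1, by
    obtain ⟨⟨z, hz⟩, p, hp, hl, hs⟩ := q
    simp only [mask] at hs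
    refine ⟨?_, by simp [hl], ?_⟩
    · rw [SimpleGraph.Walk.cons_isPath_iff]
      exact ⟨hp, fun h => (hs u h).2 rfl⟩
    · intro w hw
      rw [SimpleGraph.Walk.support_cons, List.mem_cons] at hw
      rcases hw with rfl | hw
      · exact hu
      · exact (hs w hw).1⟩

lemma join_bij (v : Fin 16) (n S : ℕ) (u : Fin 16) (hu : S.testBit u.val = false) :
    Function.Bijective (join v n S u hu) := by
  constructor
  · rintro ⟨⟨z, hz⟩, p, hp⟩ ⟨⟨z', hz'⟩, p', hp'⟩ h
    have h1 := congrArg Subtype.val h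
    simp only [join, SimpleGraph.Walk.cons.injEq] at h1
    obtain ⟨rfl, h2⟩ := h1
    obtain rfl := eq_of_heq h2
    rfl
  · rintro ⟨p, h⟩
    cases p with
    | nil => simp at h
    | cons hz p =>
      obtain ⟨hp, hl, hs⟩ := h
      have hp' := hp
      rw [SimpleGraph.Walk.cons_isPath_iff] at hp'
      refine ⟨⟨⟨_, hz⟩, p, hp'.1, by simpa using hl,
        fun w hw => (mask _ _ _).2 ⟨hs w (by simp [hw]), ?_⟩⟩, rfl⟩
      rintro rfl
      exact hp'.2 hw

lemma nb_sum (f : ℕ → ℕ) (u : Fin 16) :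
    ∑ z : {z // shr.Adj u z}, f z.1.val = ((nb u.val).map f).sum := by
  have hn : (nb u.val).Nodup := by revert u; unfold nb; decide
  have hl : ∀ x ∈ nb u.val, x < 16 := by revert u; unfold nb; decide
  rw [← List.sum_toFinset f hn]
  refine Finset.sum_bij (fun z _ => z.1.val) ?_ ?_ ?_ ?_
  · intro z _
    exact List.mem_toFinset.2 z.2
  · intro a _ b _ h
    exact Subtype.ext (Fin.ext h)
  · intro b hb
    have hb := List.mem_toFinset.1 hb
    exact ⟨⟨⟨b, hl b hb⟩, hb⟩, Finset.mem_univ _, rfl⟩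
  · intro _ _
    rfl

lemma card_good (v : Fin 16) (n : ℕ) : ∀ (S : ℕ) (u : Fin 16),
    Nat.card (Good v n S u) = cnt v.val n S u.val := by
  induction n with
  | zero =>
    intro S u
    change _ = bif Nat.testBit S u then 0 else bif Nat.beq u v then 1 else 0
    cases hS : S.testBit u.val with
    | true =>
      have : IsEmpty (Good v 0 S u) := ⟨fun p => by
        have := p.2.2.2 u p.1.start_mem_support
        simp [hS] at this⟩
      simp
    | false =>
      by_cases huv : u = v
      · subst huv
        have : Unique (Good u 0 S u) :=
          { default := ⟨SimpleGraph.Walk.nil, by simp [hS]⟩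
            uniq := by
              rintro ⟨p, hp, hl, hs⟩
              exact Subtype.ext (SimpleGraph.Walk.eq_nil_iff_nil.2
                (SimpleGraph.Walk.length_eq_zero_iff.1 hl)) }
        simp
      · have : IsEmpty (Good v 0 S u) :=
          ⟨fun p => huv (SimpleGraph.Walk.eq_of_length_eq_zero p.2.2.1)⟩
        have h2 : Nat.beq u.val v.val = false := by
          rw [← Bool.not_eq_true, Nat.beq_eq]
          exact fun h => huv (Fin.ext h)
        simp [h2]
  | succ n ih =>
    intro S u
    change _ = bif Nat.testBit S u then 0 else bif Nat.beq u v then 0 else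
        ((nb u).map (cnt v.val n (S ||| (1 <<< u.val)))).sum
    cases hS : S.testBit u.val with
    | true =>
      have : IsEmpty (Good v (n + 1) S u) := ⟨fun p => by
        have := p.2.2.2 u p.1.start_mem_support
        simp [hS] at this⟩
      simp
    | false =>
      by_cases huv : u = v
      · subst huv
        have : IsEmpty (Good u (n + 1) S u) := ⟨fun p => by
          have h1 := p.2.2.1
          rw [SimpleGraph.Walk.length_eq_zero_iff.2
            (SimpleGraph.Walk.isPath_iff_nil.1 p.2.1)] at h1
          omega⟩
        simp
      · have h2 : Nat.beq u.val v.val = false := by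
          rw [← Bool.not_eq_true, Nat.beq_eq]
          exact fun h => huv (Fin.ext h)
        rw [← Nat.card_congr (Equiv.ofBijective _ (join_bij v n S u hS)), Nat.card_sigma, h2]
        simp only [ih]
        exact nb_sum _ u

lemma card_paths (u v : Fin 16) :
    Nat.card {p : shr.Walk u v // p.IsPath ∧ p.length = 8 - 1} = cnt v.val 7 0 u.val := by
  rw [← card_good]
  refine Nat.card_congr (Equiv.subtypeEquivRight fun p => ?_)
  simp

lemma nb_lt (u : Fin 16) : ∀ x ∈ nb u.val, x < 16 := by revert u; unfold nb; decide

/-- Faster variant of `cnt v (n + 1)`; `M` is the bit mask of the neighbours of `v`. -/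
def fast (v M : ℕ) (n : ℕ) : ℕ → ℕ → ℕ :=
  Nat.rec (fun S u => bif Nat.testBit M u then
      bif Nat.testBit S u then 0 else bif Nat.testBit S v then 0 else 1 else 0)
    (fun _ ih S u => bif Nat.testBit S u then 0 else
      bif Nat.beq u v then 0 else
        ((nb u).map (ih (S ||| (1 <<< u)))).sum) n

lemma cnt_one (v : Fin 16) (M : ℕ) (hM : ∀ u : Fin 16, M.testBit u.val = true ↔ shr.Adj u v)
    (S : ℕ) (u : Fin 16) : fast v.val M 0 S u.val = cnt v.val 1 S u.val := by
  change (bif Nat.testBit M u then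
      bif Nat.testBit S u then 0 else bif Nat.testBit S v then 0 else 1 else 0) =
    bif Nat.testBit S u then 0 else bif Nat.beq u v then 0 else
        ((nb u).map (cnt v.val 0 (S ||| (1 <<< u.val)))).sum
  rw [← nb_sum]
  change _ = bif Nat.testBit S u then 0 else bif Nat.beq u v then 0 else
        ∑ z : {z // shr.Adj u z}, bif (S ||| (1 <<< u.val)).testBit z.1.val then 0 else
          bif Nat.beq z.1.val v.val then 1 else 0
  have hb : ∀ z : Fin 16, z ≠ v → Nat.beq z.val v.val = false := by
    intro z hz
    rw [← Bool.not_eq_true, Nat.beq_eq]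
    exact fun h => hz (Fin.ext h)
  by_cases h : shr.Adj u v
  · rw [(hM u).2 h, hb u h.ne]
    rw [Finset.sum_eq_single (⟨v, h⟩ : {z // shr.Adj u z})]
    · have h3 := mask S u v
      cases h4 : S.testBit v.val with
      | false =>
        rw [h3.2 ⟨h4, h.ne'⟩]
        simp
      | true =>
        have h5 : (S ||| (1 <<< u.val)).testBit v.val = true := by
          rw [Nat.testBit_or, h4, Bool.true_or]
        rw [h5]
        simp
    · intro z _ hz
      rw [hb z.1 (fun e => hz (Subtype.ext e))]
      simp
    · intro h'
      exact absurd (Finset.mem_univ _) h'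
  · have h1 : M.testBit u.val = false := by
      rw [← Bool.not_eq_true, hM]
      exact h
    rw [h1, Finset.sum_eq_zero]
    · simp
    · intro z _
      rw [hb z.1 (fun e => h (e ▸ z.2))]
      simp

lemma fast_eq (v : Fin 16) (M : ℕ) (hM : ∀ u : Fin 16, M.testBit u.val = true ↔ shr.Adj u v)
    (n : ℕ) : ∀ (S : ℕ) (u : Fin 16), fast v.val M n S u.val = cnt v.val (n + 1) S u.val := by
  induction n with
  | zero => exact cnt_one v M hM
  | succ n ih =>
    intro S u
    change (bif Nat.testBit S u then 0 else bif Nat.beq u v then 0 else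
        ((nb u).map (fast v.val M n (S ||| (1 <<< u.val)))).sum) =
      bif Nat.testBit S u then 0 else bif Nat.beq u v then 0 else
        ((nb u).map (cnt v.val (n + 1) (S ||| (1 <<< u.val)))).sum
    rw [List.map_congr_left fun x hx => ih (S ||| (1 <<< u.val)) ⟨x, nb_lt u x hx⟩]

end SrgPath

/-- There is a strongly regular graph `G` with two pairs of
distinct non-adjacent vertices `(x, y)` and `(x', y')` such that the number of
paths on `8` vertices from `x` to `y` differs from the number of paths on `8`
vertices from `x'` to `y'` (a witness is the Shrikhande graph). -/
theorem srg_path_count_not_invariant_for_eight :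
    ∃ (V : Type) (_ : Fintype V) (G : SimpleGraph V)
      (_ : DecidableRel G.Adj) (n k l m : ℕ) (x y x' y' : V),
      G.IsSRGWith n k l m ∧ x ≠ y ∧ x' ≠ y' ∧ ¬ G.Adj x y ∧ ¬ G.Adj x' y' ∧
      Nat.card {p : G.Walk x y // p.IsPath ∧ p.length = 8 - 1} ≠
      Nat.card {p : G.Walk x' y' // p.IsPath ∧ p.length = 8 - 1} := by
  refine ⟨Fin 16, inferInstance, SrgPath.shr, inferInstance, 16, 6, 2, 2, 0, 2, 0, 6,
    ⟨by decide, by unfold SimpleGraph.IsRegularOfDegree; decide +kernel, by decide +kernel,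
      by unfold Pairwise; decide +kernel⟩,
    by decide, by decide, by decide +kernel, by decide +kernel, ?_⟩
  rw [SrgPath.card_paths, SrgPath.card_paths,
    ← SrgPath.fast_eq 2 24778 (by decide +kernel) 6 0 0,
    ← SrgPath.fast_eq 6 3238 (by decide +kernel) 6 0 0]
  decide +kernel
end

section
/- There exist natural numbers n, k, λ, μ, a finite simple graph G that is strongly regular with parameters (n, k, λ, μ), and vertices x, y, x', y' of G with x ≠ y, x' ≠ y', x not adjacent to y, and x' not adjacent to y', such that the number of 6-cycles through x and y differs from the number of 6-cycles through x' and y'. (Hence the bound s ≤ 5 in the invariance of cycle counts through vertex pairs in strongly regular graphs is optimal; a witness is the Shrikhande graph.) -/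
namespace ShrikhandeSix

/-- Boolean adjacency of the Shrikhande graph on `Fin 16`, vertex `4 a + b` being the element
`(a, b)` of `ℤ/4 × ℤ/4`; the number packs the adjacency matrix. -/
def adjB (i j : Fin 16) : Bool :=
  Nat.testBit 41629829715400100489067412434957439965684887810289700744189528318077177270330
    (16 * i.val + j.val)

/-- The Shrikhande graph. -/
def shr : SimpleGraph (Fin 16) where
  Adj i j := adjB i j = true
  symm := ⟨by decide +kernel⟩
  loopless := ⟨by decide +kernel⟩

instance : DecidableRel shr.Adj := fun i j => inferInstanceAs (Decidable (adjB i j = true))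

theorem shr_srg : shr.IsSRGWith 16 6 2 2 where
  card := by decide
  regular := by
    unfold SimpleGraph.IsRegularOfDegree
    decide +kernel
  of_adj := by decide +kernel
  of_not_adj := by
    unfold Pairwise
    decide +kernel

/-- The condition that `x a b c d e` is a 6-cycle through `y`. -/
def P {V : Type} (G : SimpleGraph V) (x y : V) (t : V × V × V × V × V) : Prop :=
  G.Adj x t.1 ∧ (G.Adj t.1 t.2.1 ∧ t.2.1 ≠ x) ∧
  (G.Adj t.2.1 t.2.2.1 ∧ t.2.2.1 ∉ [x, t.1]) ∧
  (G.Adj t.2.2.1 t.2.2.2.1 ∧ t.2.2.2.1 ∉ [x, t.1, t.2.1]) ∧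
  (G.Adj t.2.2.2.1 t.2.2.2.2 ∧ t.2.2.2.2 ∉ [x, t.1, t.2.1, t.2.2.1]) ∧
  (G.Adj t.2.2.2.2 x ∧ y ∈ [x, t.1, t.2.1, t.2.2.1, t.2.2.2.1, t.2.2.2.2])

open SimpleGraph Walk in
theorem card_walks {V : Type} (G : SimpleGraph V) (x y : V) :
    Nat.card {w : G.Walk x x // w.IsCycle ∧ w.length = 6 ∧ y ∈ w.support} =
    Nat.card {t // P G x y t} := by
  symm
  refine Nat.card_eq_of_bijective (fun t => ⟨cons t.2.1 (cons t.2.2.1.1 (cons t.2.2.2.1.1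
    (cons t.2.2.2.2.1.1 (cons t.2.2.2.2.2.1.1 (cons t.2.2.2.2.2.2.1 nil))))), ?_, ?_, ?_⟩) ⟨?_, ?_⟩
  · obtain ⟨⟨a, b, c, d, e⟩, h⟩ := t
    have h' := h
    simp only [P, List.mem_cons, List.not_mem_nil, or_false, not_or] at h'
    obtain ⟨h1, ⟨h2, n2⟩, ⟨h3, n3⟩, ⟨h4, n4⟩, ⟨h5, n5⟩, h6, n6⟩ := h'
    have := h1.ne; have := h2.ne; have := h3.ne; have := h4.ne; have := h5.ne; have := h6.ne
    rw [isCycle_iff_isPath_tail_and_le_length, isPath_def]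
    simp
    grind
  · rfl
  · obtain ⟨⟨a, b, c, d, e⟩, h⟩ := t
    have := h.2.2.2.2.2.2
    simp at this ⊢
    grind
  · rintro ⟨⟨a, b, c, d, e⟩, h⟩ ⟨⟨a', b', c', d', e'⟩, h'⟩ hh
    have := congrArg (fun w => w.1.support) hh
    simp at this
    simp [this]
  · rintro ⟨w, hc, hl, hy⟩
    rcases w with _ | ⟨h1, w⟩
    · simp at hl
    rcases w with _ | ⟨h2, w⟩
    · simp at hl
    rcases w with _ | ⟨h3, w⟩
    · simp at hl
    rcases w with _ | ⟨h4, w⟩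
    · simp at hl
    rcases w with _ | ⟨h5, w⟩
    · simp at hl
    rcases w with _ | ⟨h6, w⟩
    · simp at hl
    rcases w with _ | ⟨h7, w⟩
    · rename_i a b c d e
      refine ⟨⟨(a, b, c, d, e), ?_⟩, rfl⟩
      rw [isCycle_iff_isPath_tail_and_le_length, isPath_def] at hc
      simp at hc hy
      simp [P]
      grind
    · simp at hl

/-- The nested count of 6-cycles. -/
def S (x y : Fin 16) : ℕ :=
  ∑ a, if shr.Adj x a then ∑ b, if shr.Adj a b ∧ b ≠ x then
  ∑ c, if shr.Adj b c ∧ c ∉ [x, a] then ∑ d, if shr.Adj c d ∧ d ∉ [x, a, b] then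
  ∑ e, if shr.Adj d e ∧ e ∉ [x, a, b, c] then
  (if shr.Adj e x ∧ y ∈ [x, a, b, c, d, e] then 1 else 0) else 0 else 0 else 0 else 0 else 0

theorem sum_ite_zero' {α : Type} [Fintype α] (p : Prop) [Decidable p] (f : α → ℕ) :
    (∑ a, if p then f a else 0) = if p then ∑ a, f a else 0 := by
  split_ifs <;> simp

theorem card_P (x y : Fin 16) : Nat.card {t // P shr x y t} = S x y := by
  classical
  rw [Nat.card_eq_fintype_card, Fintype.card_subtype, Finset.card_filter]
  simp only [Fintype.sum_prod_type, P]
  unfold S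
  simp only [← sum_ite_zero', ← ite_and]
  repeat refine Finset.sum_congr rfl fun _ _ => ?_
  congr

theorem S1 : S 0 2 = 236 := by decide +kernel
theorem S2 : S 0 6 = 242 := by decide +kernel

end ShrikhandeSix


/-- There is a strongly regular graph `G` with two pairs of
distinct non-adjacent vertices `(x, y)` and `(x', y')` such that the number of
`6`-cycles through `x` and `y` differs from the number of `6`-cycles through
`x'` and `y'` (a witness is the Shrikhande graph). -/
theorem srg_six_cycle_count_not_invariant :
    ∃ (V : Type) (_ : Fintype V) (G : SimpleGraph V)
      (_ : DecidableRel G.Adj) (n k l m : ℕ) (x y x' y' : V),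
      G.IsSRGWith n k l m ∧ x ≠ y ∧ x' ≠ y' ∧ ¬ G.Adj x y ∧ ¬ G.Adj x' y' ∧
      Nat.card {w : G.Walk x x // w.IsCycle ∧ w.length = 6 ∧ y ∈ w.support} ≠
      Nat.card {w : G.Walk x' x' // w.IsCycle ∧ w.length = 6 ∧ y' ∈ w.support} := by
  refine ⟨Fin 16, inferInstance, ShrikhandeSix.shr, inferInstance, 16, 6, 2, 2, 0, 2, 0, 6,
    ShrikhandeSix.shr_srg, by decide, by decide, by decide +kernel, by decide +kernel, ?_⟩
  rw [ShrikhandeSix.card_walks, ShrikhandeSix.card_walks, ShrikhandeSix.card_P,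
    ShrikhandeSix.card_P, ShrikhandeSix.S1, ShrikhandeSix.S2]
  decide
end

section
/- There exist natural numbers n, k, λ, μ, a finite simple graph G that is strongly regular with parameters (n, k, λ, μ), and vertices x, y, x', y' of G with G.Adj x y and G.Adj x' y', such that the number of 8-cycles containing the edge {x, y} differs from the number of 8-cycles containing the edge {x', y'}. (Hence the bound s ≤ 7 in the invariance of cycle counts through edges is optimal; a witness is the complement of the Shrikhande graph.) -/
/-- Adjacency matrix (as a bit string) of the complement of the Shrikhande graph. -/
def shBig : ℕ := 16265773188121783582036985201013614204681161468824324206607007665920708997060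

def shAdj (u v : ℕ) : Bool := Nat.testBit shBig (16 * u + v)

/-- The complement of the Shrikhande graph. -/
def shG : SimpleGraph (Fin 16) where
  Adj u v := shAdj u v = true
  symm := ⟨by decide +kernel⟩
  loopless := ⟨by decide +kernel⟩

instance shDec : DecidableRel shG.Adj := fun u v => inferInstanceAs (Decidable (shAdj u v = true))

lemma shG_srg : shG.IsSRGWith 16 9 4 6 where
  card := rfl
  regular := by unfold SimpleGraph.IsRegularOfDegree; decide +kernel
  of_adj := by decide +kernel
  of_not_adj := by unfold Pairwise; decide +kernel

def sumTo (f : ℕ → ℕ) : ℕ → ℕ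
  | 0 => 0
  | k + 1 => sumTo f k + f k

lemma sumTo_eq (f : ℕ → ℕ) (n : ℕ) : sumTo f n = ∑ v : Fin n, f v := by
  induction n with
  | zero => rfl
  | succ n ih => simp [sumTo, ih, Fin.sum_univ_castSucc]

/-- Number of paths of length `n + 1` from `u` to `x` with interior in the bit set `A`. -/
def cnt (x : ℕ) : ℕ → ℕ → ℕ → ℕ
  | 0, u, _ => cond (shAdj u x) 1 0
  | n + 1, u, A => sumTo (fun v => cond (Nat.testBit A v && shAdj u v) (cnt x n v (A ^^^ 2 ^ v)) 0) 16

/-- Paths of length `n + 1` from `u` to `x` with interior in the bit set `A`. -/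
def IsShPath (x : Fin 16) (n : ℕ) (u : Fin 16) (A : ℕ) (p : shG.Walk u x) : Prop :=
  p.IsPath ∧ p.length = n + 1 ∧ ∀ v ∈ p.support, v = u ∨ v = x ∨ Nat.testBit A v = true

lemma testBit_erase (A : ℕ) (v w : Fin 16) (h : Nat.testBit A v = true) :
    Nat.testBit (A ^^^ 2 ^ (v : ℕ)) w = true ↔ (w ≠ v ∧ Nat.testBit A w = true) := by
  rw [Nat.testBit_xor, Nat.testBit_two_pow]
  by_cases hw : w = v
  · subst hw; simp [h]
  · have : ¬ (v : ℕ) = w := fun e => hw (Fin.ext e.symm)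
    simp [this, hw]

lemma pset_cons (x : Fin 16) (n : ℕ) (u v : Fin 16) (A : ℕ) (h : shG.Adj u v) (p : shG.Walk v x)
    (hu : ¬ Nat.testBit A u = true) (hux : u ≠ x) :
    IsShPath x (n + 1) u A (.cons h p) ↔
      Nat.testBit A v = true ∧ IsShPath x n v (A ^^^ 2 ^ (v : ℕ)) p := by
  unfold IsShPath
  rw [SimpleGraph.Walk.cons_isPath_iff]
  simp only [SimpleGraph.Walk.length_cons, SimpleGraph.Walk.support_cons, List.mem_cons]
  constructor
  · rintro ⟨⟨hp, hus⟩, hl, hs⟩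
    have hvx : v ≠ x := by
      rintro rfl
      rw [SimpleGraph.Walk.isPath_iff_nil, ← SimpleGraph.Walk.length_eq_zero_iff] at hp
      omega
    have hvA : Nat.testBit A v = true := by
      rcases hs v (Or.inr p.start_mem_support) with h1 | h1 | h1
      · exact absurd h1.symm h.ne
      · exact absurd h1 hvx
      · exact h1
    refine ⟨hvA, hp, by omega, fun w hw => ?_⟩
    rw [testBit_erase A v w hvA]
    have hwu : w ≠ u := by rintro rfl; exact hus hw
    rcases hs w (Or.inr hw) with h1 | h1 | h1
    · exact absurd h1 hwu
    · exact Or.inr (Or.inl h1)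
    · tauto
  · rintro ⟨hvA, hp, hl, hs⟩
    refine ⟨⟨hp, fun hus => ?_⟩, by omega, fun w hw => ?_⟩
    · have := hs u hus
      rw [testBit_erase A v u hvA] at this
      have := h.ne
      tauto
    · rcases hw with hw | hw
      · exact Or.inl hw
      · have := hs w hw
        rw [testBit_erase A v w hvA] at this
        rcases this with h1 | h1 | h1
        · subst h1; exact Or.inr (Or.inr hvA)
        · tauto
        · tauto

/-- Prepending a first step. -/
def consStep (x : Fin 16) (n : ℕ) (u : Fin 16) (A : ℕ)
    (hu : ¬ Nat.testBit A u = true) (hux : u ≠ x)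
    (q : Σ v : Fin 16, {p : shG.Walk v x //
        (Nat.testBit A v = true ∧ shG.Adj u v) ∧ IsShPath x n v (A ^^^ 2 ^ (v : ℕ)) p}) :
    {p : shG.Walk u x // IsShPath x (n + 1) u A p} :=
  ⟨.cons q.2.2.1.2 q.2.1, (pset_cons x n u _ A _ _ hu hux).2 ⟨q.2.2.1.1, q.2.2.2⟩⟩

lemma consStep_bijective (x : Fin 16) (n : ℕ) (u : Fin 16) (A : ℕ)
    (hu : ¬ Nat.testBit A u = true) (hux : u ≠ x) :
    Function.Bijective (consStep x n u A hu hux) := by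
  constructor
  · rintro ⟨v, p, hp⟩ ⟨v', p', hp'⟩ h
    have h' := congrArg Subtype.val h
    simp only [consStep, SimpleGraph.Walk.cons.injEq] at h'
    obtain ⟨rfl, h2⟩ := h'
    obtain rfl := eq_of_heq h2
    rfl
  · rintro ⟨p, hp⟩
    cases p with
    | nil => exact absurd rfl hux
    | cons h p =>
      have h1 := (pset_cons x n u _ A h p hu hux).1 hp
      exact ⟨⟨_, p, ⟨h1.1, h⟩, h1.2⟩, rfl⟩

lemma finite_pset (x : Fin 16) (n : ℕ) (u : Fin 16) (Q : shG.Walk u x → Prop)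
    (hQ : ∀ p, Q p → p.length = n) : Finite {p : shG.Walk u x // Q p} := by
  have : Finite {p : shG.Walk u x // p.length = n} :=
    inferInstanceAs (Finite {p : shG.Walk u x | p.length = n})
  exact Finite.of_injective
    (fun p : {p : shG.Walk u x // Q p} => (⟨p.1, hQ _ p.2⟩ : {p : shG.Walk u x // p.length = n}))
    (fun a b h => Subtype.ext (by simpa using h))

lemma card_pset (x : Fin 16) (n : ℕ) : ∀ (u : Fin 16) (A : ℕ),
    ¬ Nat.testBit A u = true → ¬ Nat.testBit A x = true → u ≠ x →
    Nat.card {p : shG.Walk u x // IsShPath x n u A p} = cnt x n u A := by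
  induction n with
  | zero =>
    intro u A hu hx hux
    by_cases h : shG.Adj u x
    · have h' : shAdj u x = true := h
      rw [cnt, h', cond_true, Nat.card_eq_one_iff_unique]
      refine ⟨⟨?_⟩, ⟨⟨.cons h .nil, ?_⟩⟩⟩
      · rintro ⟨p, hp⟩ ⟨q, hq⟩
        apply Subtype.ext
        have h1 := hp.2.1
        have h2 := hq.2.1
        change p = q
        clear hp hq
        match p, q, h1, h2 with
        | .cons _ .nil, .cons _ .nil, _, _ => rfl
      · simp [IsShPath, hux]
    · have h' : shAdj u x = false := Bool.eq_false_iff.2 h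
      rw [cnt, h', cond_false, Nat.card_eq_zero]
      exact Or.inl ⟨fun p => h (SimpleGraph.Walk.adj_of_length_eq_one p.2.2.1)⟩
  | succ n ih =>
    intro u A hu hx hux
    rw [← Nat.card_congr (Equiv.ofBijective _ (consStep_bijective x n u A hu hux))]
    have (v : Fin 16) : Finite {p : shG.Walk v x //
        (Nat.testBit A v = true ∧ shG.Adj u v) ∧ IsShPath x n v (A ^^^ 2 ^ (v : ℕ)) p} :=
      finite_pset x (n + 1) v _ (fun p hp => hp.2.2.1)
    rw [Nat.card_sigma, cnt, sumTo_eq]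
    refine Finset.sum_congr rfl fun v _ => ?_
    by_cases h : Nat.testBit A v = true ∧ shG.Adj u v
    · have h' : shAdj u v = true := h.2
      have hvx : v ≠ x := by rintro rfl; exact hx h.1
      simp only [h, h', and_self, true_and, Bool.and_self, cond_true]
      apply ih
      · rw [testBit_erase A v v h.1]; tauto
      · rw [testBit_erase A v x h.1]; tauto
      · exact hvx
    · have h' : (Nat.testBit A v && shAdj u v) = false := by
        rw [Bool.eq_false_iff, ne_eq, Bool.and_eq_true]; exact h
      rw [h', cond_false, Nat.card_eq_zero]
      exact Or.inl ⟨fun p => h p.2.1⟩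

lemma cycle_cons (x y : Fin 16) (A : ℕ) (hA : ∀ v : Fin 16, v = y ∨ v = x ∨ Nat.testBit A v = true)
    (h : shG.Adj x y) (p : shG.Walk y x) :
    ((SimpleGraph.Walk.cons h p).IsCycle ∧ (SimpleGraph.Walk.cons h p).length = 8) ↔
      IsShPath x 6 y A p := by
  rw [SimpleGraph.Walk.cons_isCycle_iff, IsShPath, SimpleGraph.Walk.length_cons]
  constructor
  · rintro ⟨⟨hp, _⟩, hl⟩
    exact ⟨hp, by omega, fun v _ => hA v⟩
  · rintro ⟨hp, hl, _⟩
    refine ⟨⟨hp, fun he => ?_⟩, by omega⟩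
    rw [Sym2.eq_swap] at he
    have := hp.length_eq_one_of_mem_edges he
    omega

lemma card_cycle (x y : Fin 16) (A : ℕ)
    (hA : ∀ v : Fin 16, v = y ∨ v = x ∨ Nat.testBit A v = true)
    (hy : ¬ Nat.testBit A y = true) (hx : ¬ Nat.testBit A x = true) (h : shG.Adj x y) :
    Nat.card {w : shG.Walk x x // w.IsCycle ∧ w.length = 8 ∧ w.getVert 1 = y} = cnt x 6 y A := by
  rw [← card_pset x 6 y A hy hx h.ne']
  symm
  refine Nat.card_congr (Equiv.ofBijective (fun p => ⟨.cons h p.1, ?_⟩) ⟨?_, ?_⟩)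
  · have := (cycle_cons x y A hA h p.1).2 p.2
    exact ⟨this.1, this.2, by simp⟩
  · intro p q hpq
    simpa [Subtype.ext_iff] using hpq
  · rintro ⟨w, hc, hl, hv⟩
    cases w with
    | nil => simp at hl
    | cons h' p =>
      simp only [SimpleGraph.Walk.getVert_cons_succ, SimpleGraph.Walk.getVert_zero] at hv
      subst hv
      exact ⟨⟨p, (cycle_cons x _ A hA h' p).1 ⟨hc, hl⟩⟩, rfl⟩

/-- Number of ones among the four lowest bits. -/
def pop4 (m : ℕ) : ℕ := Nat.land (Nat.shiftRight 4841987667533046032 (Nat.mul 4 (Nat.land m 15))) 15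

/-- Number of ones among the sixteen lowest bits. -/
def pop16 (m : ℕ) : ℕ :=
  Nat.add (Nat.add (pop4 m) (pop4 (Nat.shiftRight m 4)))
    (Nat.add (pop4 (Nat.shiftRight m 8)) (pop4 (Nat.shiftRight m 12)))

lemma pop4_eq (m : ℕ) : pop4 m = ∑ i : Fin 4, (m.testBit i).toNat := by
  have h : ∀ k : Fin 16, pop4 k = ∑ i : Fin 4, ((k : ℕ).testBit i).toNat := by decide +kernel
  have e : m &&& 15 = m % 16 := Nat.and_two_pow_sub_one_eq_mod m 4
  have h1 : pop4 m = pop4 (m % 16) := by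
    have : m &&& 15 = (m % 16) &&& 15 := by
      rw [e, Nat.and_two_pow_sub_one_eq_mod (m % 16) 4]; simp
    change Nat.land (Nat.shiftRight _ (Nat.mul 4 (m &&& 15))) 15 =
      Nat.land (Nat.shiftRight _ (Nat.mul 4 ((m % 16) &&& 15))) 15
    rw [← this]
  rw [h1, h ⟨m % 16, Nat.mod_lt _ (by norm_num)⟩]
  refine Finset.sum_congr rfl fun i _ => ?_
  have : (m % 16).testBit i = m.testBit i := by
    rw [show 16 = 2 ^ 4 from rfl, Nat.testBit_mod_two_pow]
    simp [i.2]
  exact congrArg _ this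

lemma pop16_eq (m : ℕ) : pop16 m = ∑ i : Fin 16, (m.testBit i).toNat := by
  have hs (a b : ℕ) : Nat.shiftRight a b = a >>> b := rfl
  simp only [pop16, pop4_eq, hs, Nat.testBit_shiftRight, Nat.add_eq]
  simp only [Fin.sum_univ_succ, Fin.sum_univ_zero, Fin.val_succ, Fin.val_zero]
  simp only [Nat.reduceAdd, zero_add, add_zero]
  ring

/-- Fast version of `cnt x (n + 1) u A`. -/
def cntF (x : ℕ) : ℕ → ℕ → ℕ → ℕ
  | 0, u, A => pop16 (Nat.land (Nat.land (Nat.shiftRight shBig (Nat.mul 16 u))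
      (Nat.shiftRight shBig (Nat.mul 16 x))) A)
  | n + 1, u, A => sumTo (fun v => cond
      (Nat.beq (Nat.land (Nat.shiftRight (Nat.land (Nat.shiftRight shBig (Nat.mul 16 u)) A) v) 1) 1)
      (cntF x n v (Nat.xor A (Nat.pow 2 v))) 0) 16

lemma beq_testBit (m v : ℕ) : Nat.beq (Nat.land (Nat.shiftRight m v) 1) 1 = m.testBit v := by
  change Nat.beq ((m >>> v) &&& 1) 1 = _
  rw [Nat.testBit, Nat.and_comm]
  rcases Nat.mod_two_eq_zero_or_one (m >>> v) with h | h <;>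
    simp [Nat.one_and_eq_mod_two, h, Nat.beq]

lemma row_testBit (u A v : ℕ) :
    Nat.testBit (Nat.land (Nat.shiftRight shBig (Nat.mul 16 u)) A) v =
      (Nat.testBit A v && shAdj u v) := by
  change Nat.testBit ((shBig >>> (16 * u)) &&& A) v = _
  rw [Nat.testBit_and, Nat.testBit_shiftRight, Bool.and_comm, shAdj]

lemma shAdj_comm (u v : Fin 16) : shAdj u v = shAdj v u := by
  revert u v
  decide +kernel

lemma cntF_eq (x : Fin 16) (n : ℕ) : ∀ u A : ℕ, cntF x n u A = cnt x (n + 1) u A := by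
  induction n with
  | zero =>
    intro u A
    rw [cnt, cntF, pop16_eq, sumTo_eq]
    refine Finset.sum_congr rfl fun v _ => ?_
    change (Nat.testBit (((shBig >>> (16 * u)) &&& (shBig >>> (16 * (x : ℕ)))) &&& A) v).toNat = _
    have h1 : (shBig >>> (16 * u)).testBit v = shAdj u v := by
      rw [Nat.testBit_shiftRight, shAdj]
    have h2 : (shBig >>> (16 * (x : ℕ))).testBit v = shAdj v x := by
      rw [Nat.testBit_shiftRight, shAdj_comm, shAdj]
    rw [Nat.testBit_and, Nat.testBit_and, h1, h2, cnt]
    cases shAdj u v <;> cases shAdj v x <;> cases Nat.testBit A v <;> rfl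
  | succ n ih =>
    intro u A
    rw [cnt, cntF]
    congr 1
    funext v
    rw [beq_testBit, row_testBit, ih]
    rfl

lemma cnt_a : cnt 0 6 2 65530 = 48832 :=
  (cntF_eq 0 5 2 65530).symm.trans (by decide +kernel)

lemma cnt_b : cnt 0 6 6 65470 = 48788 :=
  (cntF_eq 0 5 6 65470).symm.trans (by decide +kernel)

/-- There is a strongly regular graph `G` with two edges
`xy` and `x'y'` such that the number of `8`-cycles containing the edge `xy`
differs from the number of `8`-cycles containing the edge `x'y'`
(a witness is the complement of the Shrikhande graph). -/
theorem srg_eight_cycle_through_edge_count_not_invariant :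
    ∃ (V : Type) (_ : Fintype V) (G : SimpleGraph V)
      (_ : DecidableRel G.Adj) (n k l m : ℕ) (x y x' y' : V),
      G.IsSRGWith n k l m ∧ G.Adj x y ∧ G.Adj x' y' ∧
      Nat.card {w : G.Walk x x // w.IsCycle ∧ w.length = 8 ∧ w.getVert 1 = y} ≠
      Nat.card {w : G.Walk x' x' // w.IsCycle ∧ w.length = 8 ∧ w.getVert 1 = y'} := by
  have h1 : shG.Adj 0 2 := by decide +kernel
  have h2 : shG.Adj 0 6 := by decide +kernel
  refine ⟨Fin 16, inferInstance, shG, shDec, 16, 9, 4, 6, 0, 2, 0, 6, shG_srg, h1, h2, ?_⟩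
  rw [card_cycle 0 2 65530 (by decide +kernel) (by decide +kernel) (by decide +kernel) h1,
    card_cycle 0 6 65470 (by decide +kernel) (by decide +kernel) (by decide +kernel) h2]
  have e1 : cnt ((0 : Fin 16) : ℕ) 6 ((2 : Fin 16) : ℕ) 65530 = 48832 := cnt_a
  have e2 : cnt ((0 : Fin 16) : ℕ) 6 ((6 : Fin 16) : ℕ) 65470 = 48788 := cnt_b
  rw [e1, e2]
  decide
end

section
/- There exist natural numbers n, k, λ, μ, a finite simple graph G that is strongly regular with parameters (n, k, λ, μ), and vertices x, y of G such that the number of paths on 8 vertices starting at x differs from the number of paths on 8 vertices starting at y. (Hence the bound s ≤ 7 in the invariance of path counts from a vertex in 1/2-regular graphs is optimal; a witness is a strongly regular graph with parameters (25, 12, 5, 6) having no nontrivial automorphisms.) -/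
namespace SRG8

/-- Neighbour lists of the graph: the vertices are the blocks of the cyclic Steiner triple system
on `ZMod 13` with base blocks `{0,1,4}` and `{0,2,7}`, adjacent when disjoint. -/
def nbT : List (List Nat) := [[2, 5, 6, 7, 8, 11, 16, 18, 21, 22],
  [3, 6, 7, 8, 9, 12, 17, 19, 22, 23],
  [0, 4, 7, 8, 9, 10, 18, 20, 23, 24],
  [1, 5, 8, 9, 10, 11, 19, 21, 24, 25],
  [2, 6, 9, 10, 11, 12, 13, 20, 22, 25],
  [0, 3, 7, 10, 11, 12, 13, 14, 21, 23],
  [0, 1, 4, 8, 11, 12, 14, 15, 22, 24],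
  [0, 1, 2, 5, 9, 12, 15, 16, 23, 25],
  [0, 1, 2, 3, 6, 10, 13, 16, 17, 24],
  [1, 2, 3, 4, 7, 11, 14, 17, 18, 25],
  [2, 3, 4, 5, 8, 12, 13, 15, 18, 19],
  [0, 3, 4, 5, 6, 9, 14, 16, 19, 20],
  [1, 4, 5, 6, 7, 10, 15, 17, 20, 21],
  [4, 5, 8, 10, 14, 16, 17, 22, 23, 25],
  [5, 6, 9, 11, 13, 15, 17, 18, 23, 24],
  [6, 7, 10, 12, 14, 16, 18, 19, 24, 25],
  [0, 7, 8, 11, 13, 15, 17, 19, 20, 25],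
  [1, 8, 9, 12, 13, 14, 16, 18, 20, 21],
  [0, 2, 9, 10, 14, 15, 17, 19, 21, 22],
  [1, 3, 10, 11, 15, 16, 18, 20, 22, 23],
  [2, 4, 11, 12, 16, 17, 19, 21, 23, 24],
  [0, 3, 5, 12, 17, 18, 20, 22, 24, 25],
  [0, 1, 4, 6, 13, 18, 19, 21, 23, 25],
  [1, 2, 5, 7, 13, 14, 19, 20, 22, 24],
  [2, 3, 6, 8, 14, 15, 20, 21, 23, 25],
  [3, 4, 7, 9, 13, 15, 16, 21, 22, 24]]

/-- The adjacency rows packed in base 256. -/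
def rowT : List Nat := [96155115745575850275354376903553902416888218102333440,
  24615709630867417670490720487309799018723383834197360640,
  6301621665502058923645624424468898945141515837607273037825,
  1613215146368527084453279852664038129956228054427461897683200,
  1606938140041423081297346642676417432714067195459227221032960,
  24520302798273378444885825236529117235629167202747285505,
  6277197516357984881890771240269044408669396379956053803265,
  1606962564187644129764037437488592959015713802844802522349825,
  6277101735386680851288357742171262338767119874479884402945,
  1606938044258990297929819581995843158724382687866850407153920,
  5731291517351618504797361653355942685645537280,
  1467210628442014316945714979607450903578006257665,
  375605920881155665138103034779507431315969601962240,
  1606962659968615433969202046781264249217324038780210359828480,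
  6301621664040557373428336686303963554639189762833530224640,
  1613215145994382687597654191693814669987632579285383737507840,
  1606938044260457486257177434278929271149973888663270964854785,
  375605943095127536088549578313000759826348416958720,
  96155121432352649238648409638524542845121247490146305,
  24615711086682278205093992867462282968351039357477454080,
  6301622038190663220504062174070344439897866075514228244480,
  1613215241776809784449039916541725767010202044907695179300865,
  1606962564561794280211922995344170108927757087975000063869185,
  6277197517825195509991168790204049425499783628997764645120,
  1606962564563250050557739210292236652927944609023427749150720,
  6277197890502404038942195495239313473505172026485196718080]

def look {α : Type} (d : α) (l : List α) : Nat → α :=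
  List.rec (fun _ => d) (fun a _ ih u => Nat.rec a (fun m _ => ih m) u) l

def nb (u : Nat) : List Nat := look [] nbT u
def row (u : Nat) : Nat := look 0 rowT u

def loop (S : Nat) (g : Nat → Nat) (l : List Nat) : Nat :=
  List.rec 0 (fun u _ ih => Nat.add (Bool.rec 0 (g u) (Nat.beq (Nat.land S (Nat.pow 256 u)) 0)) ih) l

def leaf (v S D : Nat) : Nat :=
  Nat.mod (Nat.land D (Nat.mul 255 (Nat.sub (row v) (Nat.land (row v) S)))) 255

def f (k : Nat) : Nat → Nat → Nat → Nat :=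
  Nat.rec leaf
    (fun _ ih v S D => loop S
      (fun w => ih w (Nat.add S (Nat.pow 256 w)) (Nat.sub D (row w))) (nb v)) k

def D0 : Nat := Nat.mul 10 (Nat.div (Nat.sub (Nat.pow 256 26) 1) 255)

def total (x : Nat) : Nat := f 5 x (Nat.pow 256 x) (Nat.sub D0 (row x))


/-! ### Graph -/

def GG : SimpleGraph (Fin 26) where
  Adj u v := v.val ∈ nb u.val
  symm := ⟨by
    have h : ∀ u v : Fin 26, v.val ∈ nb u.val → u.val ∈ nb v.val := by decide +kernel
    exact h⟩
  loopless := ⟨by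
    have h : ∀ u : Fin 26, ¬ u.val ∈ nb u.val := by decide +kernel
    exact h⟩

instance : DecidableRel GG.Adj := fun u v => inferInstanceAs (Decidable (v.val ∈ nb u.val))

theorem GG_adj (u v : Fin 26) : GG.Adj u v ↔ v.val ∈ nb u.val := Iff.rfl

theorem nb_nodup : ∀ u : Fin 26, (nb u.val).Nodup := by decide +kernel
theorem nb_lt : ∀ u : Fin 26, ∀ w ∈ nb u.val, w < 26 := by decide +kernel

theorem common_card (u v : Fin 26) : Fintype.card (GG.commonNeighbors u v) =
    ((List.finRange 26).filter fun w => decide (w.val ∈ nb u.val ∧ w.val ∈ nb v.val)).length := by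
  rw [Fintype.card_subtype]
  have : (Finset.univ.filter fun w => w ∈ GG.commonNeighbors u v) =
      ((List.finRange 26).filter
        fun w => decide (w.val ∈ nb u.val ∧ w.val ∈ nb v.val)).toFinset := by
    ext w
    simp [SimpleGraph.mem_commonNeighbors, GG_adj]
  rw [this, List.toFinset_card_of_nodup]
  exact (List.nodup_finRange 26).filter _

theorem adj_card : ∀ u : Fin 26, (Finset.univ.filter fun w => GG.Adj u w).card = 10 := by
  decide +kernel

theorem GG_srg : GG.IsSRGWith 26 10 3 4 where
  card := by simp
  regular := by
    intro u
    rw [← adj_card u, ← SimpleGraph.card_neighborFinset_eq_degree,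
      SimpleGraph.neighborFinset_eq_filter]
  of_adj := by
    have h : ∀ u v : Fin 26, v.val ∈ nb u.val → ((List.finRange 26).filter
      fun w => decide (w.val ∈ nb u.val ∧ w.val ∈ nb v.val)).length = 3 := by decide +kernel
    intro u v huv
    rw [common_card]
    exact h u v huv
  of_not_adj := by
    have h : ∀ u v : Fin 26, u ≠ v → ¬ v.val ∈ nb u.val → ((List.finRange 26).filter
      fun w => decide (w.val ∈ nb u.val ∧ w.val ∈ nb v.val)).length = 4 := by decide +kernel
    intro u v huv hn
    rw [common_card]
    exact h u v huv hn

/-! ### Specification of the path count -/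

def cnt : ℕ → Fin 26 → Finset (Fin 26) → ℕ
  | 0, _, _ => 1
  | k + 1, v, S => ∑ u, if GG.Adj v u ∧ u ∉ S then cnt k u (insert u S) else 0

abbrev PS (k : ℕ) (v : Fin 26) (S : Finset (Fin 26)) : Type :=
  Σ z, {p : GG.Walk v z // p.length = k ∧ p.IsPath ∧ ∀ w ∈ p.support.tail, w ∉ S}

theorem cons_cond {v u z : Fin 26} {S : Finset (Fin 26)} (hv : v ∈ S) (h : GG.Adj v u)
    (p : GG.Walk u z) :
    ((SimpleGraph.Walk.cons h p).IsPath ∧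
      ∀ w ∈ (SimpleGraph.Walk.cons h p).support.tail, w ∉ S) ↔
    u ∉ S ∧ p.IsPath ∧ ∀ w ∈ p.support.tail, w ∉ insert u S := by
  rw [SimpleGraph.Walk.cons_isPath_iff, SimpleGraph.Walk.support_cons, List.tail_cons]
  have hs : p.support = u :: p.support.tail := p.cons_tail_support.symm
  constructor
  · rintro ⟨⟨hp, _⟩, hS⟩
    refine ⟨hS u (by simp), hp, fun w hw => ?_⟩
    have hnd := hp.support_nodup
    rw [hs, List.nodup_cons] at hnd
    rw [Finset.mem_insert, not_or]
    refine ⟨?_, hS w (List.mem_of_mem_tail hw)⟩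
    rintro rfl
    exact hnd.1 hw
  · rintro ⟨hu, hp, hS⟩
    have key : ∀ w ∈ p.support, w ∉ S := by
      intro w hw
      rw [hs, List.mem_cons] at hw
      rcases hw with rfl | hw
      · exact hu
      · exact fun h => hS w hw (Finset.mem_insert_of_mem h)
    exact ⟨⟨hp, fun h => key v h hv⟩, key⟩

def PSequiv (k : ℕ) (v : Fin 26) (S : Finset (Fin 26)) (hv : v ∈ S) :
    PS (k + 1) v S ≃ Σ u : {u // GG.Adj v u ∧ u ∉ S}, PS k u.1 (insert u.1 S) where
  toFun
    | ⟨_, ⟨.nil, hp⟩⟩ => absurd hp.1 (by simp)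
    | ⟨z, ⟨.cons (v := u) h p, hp⟩⟩ =>
      ⟨⟨u, h, ((cons_cond hv h p).1 hp.2).1⟩, z, p,
        by simpa using hp.1, ((cons_cond hv h p).1 hp.2).2⟩
  invFun
    | ⟨⟨_, hu⟩, z, p, hp⟩ => ⟨z, .cons hu.1 p, by simpa using hp.1,
        (cons_cond hv hu.1 p).2 ⟨hu.2, hp.2⟩⟩
  left_inv := by
    rintro ⟨z, ⟨_ | ⟨h, p⟩, hp⟩⟩
    · exact absurd hp.1 (by simp)
    · rfl
  right_inv := by
    rintro ⟨⟨_, hu⟩, z, p, hp⟩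
    rfl

theorem PS_card (k : ℕ) : ∀ (v : Fin 26) (S : Finset (Fin 26)), v ∈ S →
    Finite (PS k v S) ∧ Nat.card (PS k v S) = cnt k v S := by
  induction k with
  | zero =>
    intro v S hv
    have : Unique (PS 0 v S) :=
      { default := ⟨v, .nil, by simp⟩
        uniq := by
          rintro ⟨z, ⟨_ | ⟨h, p⟩, hp⟩⟩
          · rfl
          · exact absurd hp.1 (by simp) }
    exact ⟨inferInstance, by simp [cnt]⟩
  | succ k ih =>
    intro v S hv
    have hfin : ∀ u : {u // GG.Adj v u ∧ u ∉ S}, Finite (PS k u.1 (insert u.1 S)) :=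
      fun u => (ih _ _ (Finset.mem_insert_self _ _)).1
    refine ⟨Finite.of_equiv _ (PSequiv k v S hv).symm, ?_⟩
    rw [Nat.card_congr (PSequiv k v S hv), Nat.card_sigma, cnt, ← Finset.sum_filter]
    rw [Finset.sum_subtype (p := fun u => GG.Adj v u ∧ u ∉ S) _ (by simp)]
    exact Finset.sum_congr rfl fun u _ => (ih _ _ (Finset.mem_insert_self _ _)).2

theorem path_card (x : Fin 26) :
    Nat.card (Σ z, {p : GG.Walk x z // p.IsPath ∧ p.length = 8 - 1}) = cnt 7 x {x} := by
  rw [← (PS_card 7 x {x} (by simp)).2]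
  refine Nat.card_congr (Equiv.sigmaCongrRight fun z => Equiv.subtypeEquivRight fun p => ?_)
  constructor
  · rintro ⟨hp, hl⟩
    refine ⟨hl, hp, fun w hw => ?_⟩
    have hnd := hp.support_nodup
    rw [← p.cons_tail_support, List.nodup_cons] at hnd
    rw [Finset.mem_singleton]
    rintro rfl
    exact hnd.1 hw
  · rintro ⟨hl, hp, -⟩
    exact ⟨hp, hl⟩

/-! ### Packed arithmetic -/

def pack {n : ℕ} (d : Fin n → ℕ) : ℕ := ∑ b, d b * 256 ^ b.val

theorem pack_succ {n : ℕ} (d : Fin (n + 1) → ℕ) :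
    pack d = d 0 + 256 * pack (fun b => d b.succ) := by
  simp only [pack, Fin.sum_univ_succ, Finset.mul_sum]
  simp only [Fin.val_zero, pow_zero, mul_one, Fin.val_succ, pow_succ]
  congr 1
  exact Finset.sum_congr rfl fun b _ => by ring

theorem land_split (a b x y : ℕ) (ha : a < 256) (hb : b < 256) :
    (a + 256 * x) &&& (b + 256 * y) = (a &&& b) + 256 * (x &&& y) := by
  have hab : (a &&& b) < 2 ^ 8 := Nat.and_lt_two_pow _ hb
  have e : (256 : ℕ) = 2 ^ 8 := by norm_num
  rw [e] at ha hb ⊢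
  rw [add_comm a, add_comm b, add_comm (a &&& b)]
  apply Nat.eq_of_testBit_eq
  intro i
  rw [Nat.testBit_and, Nat.testBit_two_pow_mul_add _ ha, Nat.testBit_two_pow_mul_add _ hb,
    Nat.testBit_two_pow_mul_add _ hab]
  split_ifs <;> simp

theorem pack_land {n : ℕ} (d e : Fin n → ℕ) (hd : ∀ b, d b < 256) (he : ∀ b, e b < 256) :
    pack d &&& pack e = pack fun b => d b &&& e b := by
  induction n with
  | zero => simp [pack]
  | succ n ih =>
    rw [pack_succ, pack_succ, pack_succ, land_split _ _ _ _ (hd 0) (he 0),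
      ih _ _ (fun b => hd _) (fun b => he _)]

theorem pack_mod {n : ℕ} (d : Fin n → ℕ) (h : ∑ b, d b < 255) : pack d % 255 = ∑ b, d b := by
  have : pack d ≡ ∑ b, d b [MOD 255] := by
    unfold pack
    induction (Finset.univ : Finset (Fin n)) using Finset.induction_on with
    | empty => simp; rfl
    | insert a s ha ih =>
      rw [Finset.sum_insert ha, Finset.sum_insert ha]
      refine Nat.ModEq.add ?_ ih
      have h1 : 256 ^ a.val ≡ 1 ^ a.val [MOD 255] := Nat.ModEq.pow _ (by decide)
      simpa using h1.mul_left (d a)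
  rw [this, Nat.mod_eq_of_lt h]

theorem pack_add {n : ℕ} (d e : Fin n → ℕ) : pack d + pack e = pack fun b => d b + e b := by
  simp [pack, add_mul, Finset.sum_add_distrib]

theorem pack_mul {n : ℕ} (c : ℕ) (e : Fin n → ℕ) : c * pack e = pack fun b => c * e b := by
  simp [pack, Finset.mul_sum, mul_assoc]

theorem pack_single (u : Fin 26) : pack (fun b => if b = u then 1 else 0) = 256 ^ u.val := by
  simp [pack]

theorem pack_eq_zero {n : ℕ} (d : Fin n → ℕ) : pack d = 0 ↔ ∀ b, d b = 0 := by
  simp [pack]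

/-- indicator -/
def ind (S : Finset (Fin 26)) (b : Fin 26) : ℕ := if b ∈ S then 1 else 0

def NS (v : Fin 26) : Finset (Fin 26) := Finset.univ.filter fun w => GG.Adj v w

theorem row_eq : ∀ u : Fin 26, row u.val = pack (ind (NS u)) := by decide +kernel

def dg (S : Finset (Fin 26)) (b : Fin 26) : ℕ := (NS b \ S).card

theorem NS_card (u : Fin 26) : (NS u).card = 10 := adj_card u

theorem mem_NS (u v : Fin 26) : v ∈ NS u ↔ GG.Adj u v := by simp [NS]

theorem D0_eq : D0 = pack (dg ∅) := by
  have : dg ∅ = fun _ => 10 := by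
    funext b
    simp [dg, NS_card]
  rw [this]
  decide +kernel

theorem dg_insert (S : Finset (Fin 26)) (w : Fin 26) (hw : w ∉ S) :
    pack (dg (insert w S)) = pack (dg S) - row w.val := by
  rw [row_eq]
  refine Nat.eq_sub_of_add_eq ?_
  rw [pack_add]
  congr 1
  funext b
  simp only [dg, ind, mem_NS]
  rw [show NS b \ insert w S = (NS b \ S).erase w by
    ext z; simp only [Finset.mem_sdiff, Finset.mem_insert, Finset.mem_erase]; tauto]
  by_cases h : GG.Adj w b
  · rw [if_pos h, Finset.card_erase_add_one]
    simp [mem_NS, h.symm, hw]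
  · rw [if_neg h, Finset.erase_eq_of_notMem, add_zero]
    simp only [Finset.mem_sdiff, mem_NS]
    exact fun hh => h hh.1.symm

theorem ind_insert (S : Finset (Fin 26)) (w : Fin 26) (hw : w ∉ S) :
    pack (ind (insert w S)) = pack (ind S) + 256 ^ w.val := by
  rw [← pack_single, pack_add]
  congr 1
  funext b
  by_cases h : b = w
  · subst h; simp [ind, hw]
  · simp [ind, h]

theorem ind_lt (S : Finset (Fin 26)) (b : Fin 26) : ind S b < 256 := by
  unfold ind; split_ifs <;> norm_num

theorem test_eq (S : Finset (Fin 26)) (w : Fin 26) :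
    Nat.beq (Nat.land (pack (ind S)) (Nat.pow 256 w.val)) 0 = decide (w ∉ S) := by
  have h : Nat.land (pack (ind S)) (Nat.pow 256 w.val) = 0 ↔ w ∉ S := by
    change pack (ind S) &&& 256 ^ w.val = 0 ↔ _
    rw [← pack_single, pack_land _ _ (ind_lt S) (by intro b; split_ifs <;> norm_num),
      pack_eq_zero]
    constructor
    · intro h hw
      have := h w
      simp [ind, hw] at this
    · intro hw b
      by_cases hb : b = w
      · subst hb; simp [ind, hw]
      · simp [hb]
  by_cases hw : w ∉ S
  · rw [h.2 hw]; simp [hw]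
  · rw [decide_eq_false hw]
    have := mt h.1 hw
    cases hb : Nat.beq (Nat.land (pack (ind S)) (Nat.pow 256 w.val)) 0
    · rfl
    · exact absurd (Nat.eq_of_beq_eq_true hb) this

theorem loop_eq (S : ℕ) (g : ℕ → ℕ) (l : List ℕ) : loop S g l =
    (l.map fun u => if Nat.beq (Nat.land S (Nat.pow 256 u)) 0 = true then g u else 0).sum := by
  induction l with
  | nil => rfl
  | cons u l ih =>
    rw [List.map_cons, List.sum_cons, ← ih]
    change Nat.add (Bool.rec 0 (g u) (Nat.beq (Nat.land S (Nat.pow 256 u)) 0)) (loop S g l) = _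
    cases Nat.beq (Nat.land S (Nat.pow 256 u)) 0 <;> rfl

theorem nb_sum (v : Fin 26) (F : ℕ → ℕ) :
    ((nb v.val).map F).sum = ∑ w, if GG.Adj v w then F w.val else 0 := by
  rw [← Finset.sum_filter, ← List.sum_toFinset F (nb_nodup v)]
  symm
  refine Finset.sum_bij (fun w _ => w.val) ?_ ?_ ?_ ?_
  · intro w hw
    simpa [GG_adj] using hw
  · intro a _ b _ h
    exact Fin.ext h
  · intro b hb
    rw [List.mem_toFinset] at hb
    exact ⟨⟨b, nb_lt v b hb⟩, by simpa [GG_adj] using hb, rfl⟩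
  · intro a _
    rfl

theorem cnt_one (v : Fin 26) (S : Finset (Fin 26)) : cnt 1 v S = (NS v \ S).card := by
  simp only [cnt]
  rw [← Finset.sum_filter, Finset.sum_const, smul_eq_mul, mul_one]
  congr 1
  ext w
  simp [mem_NS]

theorem cnt_two (v : Fin 26) (S : Finset (Fin 26)) :
    cnt 2 v S = ∑ u, if GG.Adj v u ∧ u ∉ S then dg S u else 0 := by
  rw [cnt]
  refine Finset.sum_congr rfl fun u _ => ?_
  split_ifs with h
  · rw [cnt_one, dg]
    congr 1
    ext w
    simp only [Finset.mem_sdiff, Finset.mem_insert, mem_NS, not_or]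
    constructor
    · rintro ⟨a, -, b⟩; exact ⟨a, b⟩
    · rintro ⟨a, b⟩; exact ⟨a, a.ne', b⟩
  · rfl

theorem dg_le (S : Finset (Fin 26)) (b : Fin 26) : dg S b ≤ 10 := by
  rw [← NS_card b]
  exact Finset.card_le_card Finset.sdiff_subset

theorem leaf_eq (v : Fin 26) (S : Finset (Fin 26)) :
    leaf v.val (pack (ind S)) (pack (dg S)) = cnt 2 v S := by
  change (pack (dg S) &&& (255 * (row v.val - (row v.val &&& pack (ind S))))) % 255 = _
  have h1 : row v.val - (row v.val &&& pack (ind S)) = pack (ind (NS v \ S)) := by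
    rw [row_eq, pack_land _ _ (ind_lt _) (ind_lt _)]
    refine Nat.sub_eq_of_eq_add ?_
    rw [pack_add]
    congr 1
    funext b
    by_cases hb : b ∈ S <;> by_cases hv : b ∈ NS v <;> simp [ind, hb, hv]
  rw [h1, pack_mul, pack_land]
  · have h2 : (fun b => dg S b &&& 255 * ind (NS v \ S) b) =
        fun u => if GG.Adj v u ∧ u ∉ S then dg S u else 0 := by
      funext b
      have hb := dg_le S b
      simp only [ind, Finset.mem_sdiff, mem_NS]
      split_ifs with h
      · rw [mul_one, show 255 = 2 ^ 8 - 1 by norm_num, Nat.and_two_pow_sub_one_eq_mod]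
        exact Nat.mod_eq_of_lt (by omega)
      · simp
    rw [h2, pack_mod, cnt_two]
    rw [← Finset.sum_filter]
    calc _ ≤ ∑ u ∈ Finset.univ.filter (fun u => GG.Adj v u ∧ u ∉ S), 10 :=
          Finset.sum_le_sum fun u _ => dg_le S u
      _ ≤ ∑ u ∈ NS v, 10 := by
          refine Finset.sum_le_sum_of_subset fun u hu => ?_
          simp only [Finset.mem_filter] at hu
          exact (mem_NS _ _).2 hu.2.1
      _ < 255 := by simp [NS_card]
  · intro b
    have := dg_le S b
    omega
  · intro b
    unfold ind
    split_ifs <;> norm_num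

theorem f_eq (k : ℕ) : ∀ (v : Fin 26) (S : Finset (Fin 26)),
    f k v.val (pack (ind S)) (pack (dg S)) = cnt (k + 2) v S := by
  induction k with
  | zero => exact leaf_eq
  | succ k ih =>
    intro v S
    change loop (pack (ind S)) (fun w => f k w (pack (ind S) + 256 ^ w)
      (pack (dg S) - row w)) (nb v.val) = _
    rw [loop_eq, nb_sum, show k + 1 + 2 = (k + 2) + 1 from rfl, cnt]
    refine Finset.sum_congr rfl fun w _ => ?_
    rw [test_eq]
    by_cases hw : w ∉ S
    · simp only [hw, ← ih, ind_insert S w hw, dg_insert S w hw, not_false_eq_true, and_true,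
        decide_true, if_true]
    · simp [hw]

theorem total_eq (x : Fin 26) : total x.val = cnt 7 x {x} := by
  rw [← f_eq 5 x {x}]
  have h1 : pack (ind {x}) = 256 ^ x.val := by
    rw [← pack_single]; congr 1; funext b; simp [ind]
  have h2 : pack (dg {x}) = D0 - row x.val := by
    rw [D0_eq, ← dg_insert ∅ x (by simp)]; rfl
  rw [h1, h2]
  rfl

theorem total0 : total 0 = 2965266 := by decide +kernel
theorem total13 : total 13 = 2965398 := by decide +kernel

end SRG8

/-- There is a strongly regular graph `G` with two vertices
`x` and `y` such that the number of paths on `8` vertices starting at `x`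
differs from the number of paths on `8` vertices starting at `y` (a witness is
a strongly regular graph with parameters `(25, 12, 5, 6)` without nontrivial
automorphisms). -/
theorem srg_path_count_from_vertex_not_invariant_for_eight :
    ∃ (V : Type) (_ : Fintype V) (G : SimpleGraph V)
      (_ : DecidableRel G.Adj) (n k l m : ℕ) (x y : V),
      G.IsSRGWith n k l m ∧
      Nat.card (Σ z : V, {p : G.Walk x z // p.IsPath ∧ p.length = 8 - 1}) ≠
      Nat.card (Σ z : V, {p : G.Walk y z // p.IsPath ∧ p.length = 8 - 1}) := by

  refine ⟨Fin 26, inferInstance, SRG8.GG, inferInstance, 26, 10, 3, 4, 0, 13, SRG8.GG_srg, ?_⟩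
  rw [SRG8.path_card, SRG8.path_card, ← SRG8.total_eq, ← SRG8.total_eq]
  change SRG8.total 0 ≠ SRG8.total 13
  rw [SRG8.total0, SRG8.total13]
  norm_num
end
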